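/- Let G be a vertex-minimal triangle-free, fork-free graph with chromatic number at least 4. Let C be a 5-cycle in G, let u1, u2 be distinct vertices at distance exactly 2 from C, and let v be a vertex of C. Then G does not contain two independent paths of length 2 from v to u1 and from v to u2. -/

import Mathlib

open SimpleGraph

/-- The fork: `K_{1,4}` with two edges subdivided. Vertex 0 is the center,
adjacent to leaves 1, 2 and to 3, 5; paths 0-3-4 and 0-5-6. -/
def fork : SimpleGraph (Fin 7) :=
  SimpleGraph.fromEdgeSet {s(0, 1), s(0, 2), s(0, 3), s(0, 5), s(3, 4), s(5, 6)}

/-- A graph is fork-free if it has no induced subgraph isomorphic to the fork. -/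
def ForkFree {V : Type} (G : SimpleGraph V) : Prop :=
  IsEmpty (fork ↪g G)

/-- `G` is a vertex-minimal triangle-free, fork-free graph with chromatic
number at least 4: every smaller triangle-free fork-free graph is 3-colorable. -/
def MinCex {V : Type} [Fintype V] (G : SimpleGraph V) : Prop :=
  G.CliqueFree 3 ∧ ForkFree G ∧ 4 ≤ G.chromaticNumber ∧
    ∀ (W : Type) [Fintype W] (H : SimpleGraph W),
      Fintype.card W < Fintype.card V → H.CliqueFree 3 → ForkFree H →
        H.chromaticNumber ≤ 3

/-- `c` describes a 5-cycle in `G`. -/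
def IsC5 {V : Type} (G : SimpleGraph V) (c : Fin 5 → V) : Prop :=
  Function.Injective c ∧ ∀ i : Fin 5, G.Adj (c i) (c (i + 1))

/-- Distance from a vertex `u` to the 5-cycle `c`. -/
noncomputable def distC {V : Type} (G : SimpleGraph V) (c : Fin 5 → V) (u : V) : ℕ :=
  Finset.univ.inf' Finset.univ_nonempty fun i => G.dist u (c i)


namespace ForkProof

/-! ### The certificate checker -/

/-- Bit test, written so that the kernel evaluates it quickly. -/
def tb (m i : ℕ) : Bool := Nat.beq (Nat.land (Nat.shiftRight m i) 1) 1

/-- Row `i` of a matrix with 16-bit rows. -/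
def row (A i : ℕ) : ℕ := Nat.land (Nat.shiftRight A (Nat.mul 16 i)) 65535

/-- Base 16 digit. -/
def dg (p i : ℕ) : ℕ := Nat.land (Nat.shiftRight p (Nat.mul 4 i)) 15

/-- Disjointness of bit masks. -/
def dj (x y : ℕ) : Bool := Nat.beq (Nat.land x y) 0

def pw (n : ℕ) : ℕ := Nat.pow 2 n

def allLt : ℕ → (ℕ → Bool) → Bool
  | 0, _ => true
  | n + 1, p => p n && allLt n p

def xnor (x y : Bool) : Bool := cond x y (!y)

def K3 : ℕ := 12885229574

def nthF : List (ℕ × ℕ) → ℕ → ℕ × ℕ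
  | [], _ => (3, K3)
  | q :: _, 0 => q
  | _ :: L, i + 1 => nthF L i

/-- The pattern `p` (without its role `r`) is an induced copy in the known part. -/
def patOK (FB : List (ℕ × ℕ)) (n : ℕ) (a : ℕ → ℕ → Bool) (p : ℕ) : Bool :=
  match nthF FB (dg p 0) with
  | (k, F) => allLt k fun i => Nat.beq i (dg p 1) || (Nat.blt (dg p (i + 2)) n &&
      allLt i fun j => Nat.beq j (dg p 1) || (!(Nat.beq (dg p (i + 2)) (dg p (j + 2))) &&
        xnor (a (dg p (i + 2)) (dg p (j + 2))) (tb (row F i) j)))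

/-- The pattern `p` kills the type `m`. -/
def patKill (FB : List (ℕ × ℕ)) (p m : ℕ) : Bool :=
  match nthF FB (dg p 0) with
  | (k, F) => allLt k fun i => Nat.beq i (dg p 1) ||
      xnor (tb m (dg p (i + 2))) (cond (Nat.blt i (dg p 1)) (tb (row F (dg p 1)) i) (tb (row F i) (dg p 1)))

def allP (FB : List (ℕ × ℕ)) (n : ℕ) (a : ℕ → ℕ → Bool) : List ℕ → Bool
  | [] => true
  | p :: ps => patOK FB n a p && allP FB n a ps

def killed (FB : List (ℕ × ℕ)) : List ℕ → ℕ → Bool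
  | [], _ => false
  | p :: ps, m => patKill FB p m || killed FB ps m

/-- The list `es` is obtained from `cs` by removing elements satisfying `q`. -/
def walk (q : ℕ → Bool) : List ℕ → List ℕ → Bool
  | [], _ => true
  | c :: cs, [] => q c && walk q cs []
  | c :: cs, e :: es => cond (Nat.beq c e) (walk q cs es) (q c && walk q cs (e :: es))

def cands (n m : ℕ) : List ℕ → List ℕ
  | [] => [pw n]
  | x :: E => cond (dj x m) (x :: Nat.lor x (pw n) :: cands n m E) (x :: cands n m E)

def indep (A : ℕ) : ℕ → List ℕ
  | 0 => []
  | k + 1 => cands k (row A k) (indep A k)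

def memb (j : ℕ) : List ℕ → Bool
  | [] => false
  | x :: L => Nat.beq j x || memb j L

def allB (p : ℕ → Bool) : List ℕ → Bool
  | [] => true
  | x :: L => p x && allB p L

def extOK (n m A A' : ℕ) : Bool :=
  Nat.beq (row A' n) m &&
    allLt n fun i => Nat.beq (row A' i) (cond (tb m i) (Nat.lor (row A i) (pw n)) (row A i))

def okc (A : ℕ) (E : List ℕ) (v c d : ℕ) : Bool :=
  dj (row A v) c && allB (fun m => !(tb m v) || !(dj m d)) E

def colR (A : ℕ) (E : List ℕ) (d0 d1 d2 : ℕ) : List ℕ → ℕ → ℕ → ℕ → Bool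
  | [], _, _, _ => true
  | v :: R, c0, c1, c2 =>
    (okc A E v c0 d0 && colR A E d0 d1 d2 R (Nat.lor c0 (pw v)) c1 c2) ||
    ((okc A E v c1 d1 && colR A E d0 d1 d2 R c0 (Nat.lor c1 (pw v)) c2) ||
    (okc A E v c2 d2 && colR A E d0 d1 d2 R c0 c1 (Nat.lor c2 (pw v))))

def colQ (A : ℕ) (E R : List ℕ) : List ℕ → ℕ → ℕ → ℕ → Bool
  | [], c0, c1, c2 => colR A E c0 c1 c2 R c0 c1 c2
  | v :: Q, c0, c1, c2 =>
    (!(dj (row A v) c0) || colQ A E R Q (Nat.lor c0 (pw v)) c1 c2) &&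
    ((!(dj (row A v) c1) || colQ A E R Q c0 (Nat.lor c1 (pw v)) c2) &&
    (!(dj (row A v) c2) || colQ A E R Q c0 c1 (Nat.lor c2 (pw v))))

def checkE (n A : ℕ) (E R Q : List ℕ) : Bool :=
  match R with
  | [] => false
  | r :: R => allB (fun v => Nat.blt v n &&
        allLt n fun j => !(tb (row A v) j) || memb j (r :: R) || memb j Q) (r :: R) &&
      (allB (fun v => Nat.blt v n && !(memb v (r :: R))) Q && colQ A E (r :: R) Q 0 0 0)

def sel (k a b c : ℕ) : ℕ :=
  match k with
  | 0 => a
  | 1 => b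
  | _ => c

def extAdj (n A m i j : ℕ) : Bool :=
  cond (Nat.beq i n) (tb m j) (cond (Nat.beq j n) (tb m i) (tb (row A i) j))

def pairOK (FB : List (ℕ × ℕ)) (n m c : ℕ) (ps : List ℕ) : List (ℕ × ℕ × List ℕ) → Bool
  | [] => true
  | (m', c', _) :: L => (!(Nat.beq c c') || (!(dj m m') || killed FB ps (Nat.lor m' (pw n)))) &&
      pairOK FB n m c ps L

def entries (FB : List (ℕ × ℕ)) (n A k0 k1 k2 : ℕ) : List ℕ → List (ℕ × ℕ × List ℕ) → Bool
  | [], _ => true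
  | _ :: _, [] => false
  | e :: E, (m, c, ps) :: L => (Nat.beq e m && (Nat.blt c 3 && dj m (sel c k0 k1 k2))) &&
      ((allP FB (n + 1) (extAdj n A m) ps && (killed FB ps (pw n) &&
        pairOK FB n m c ps ((m, c, ps) :: L))) && entries FB n A k0 k1 k2 E L)

def colOf (k0 k1 i : ℕ) : ℕ := cond (tb k0 i) 0 (cond (tb k1 i) 1 2)

def checkB (FB : List (ℕ × ℕ)) (n A : ℕ) (E : List ℕ) (k0 k1 k2 : ℕ)
    (L : List (ℕ × ℕ × List ℕ)) : Bool :=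
  (Nat.blt 0 n && allLt n fun i => tb (sel (colOf k0 k1 i) k0 k1 k2) i &&
    dj (row A i) (sel (colOf k0 k1 i) k0 k1 k2)) && entries FB n A k0 k1 k2 E L

/-- Certificates. -/
inductive Tree where
  | split (m A : ℕ) (E ps Er : List ℕ) (sub rest : Tree)
  | ext (R Q : List ℕ)
  | col (k0 k1 k2 : ℕ) (L : List (ℕ × ℕ × List ℕ))

def check (FB : List (ℕ × ℕ)) : Tree → ℕ → ℕ → List ℕ → Bool
  | .split m A' E' ps Er sub rest, n, A, E =>
    (extOK n m A A' && (allP FB (n + 1) (fun i j => tb (row A' i) j) ps &&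
      (walk (killed FB ps) (cands n m E) E' && walk (Nat.beq m) E Er))) &&
      (check FB sub (n + 1) A' E' && check FB rest n A Er)
  | .ext R Q, n, A, E => checkE n A E R Q
  | .col k0 k1 k2 L, n, A, E => checkB FB n A E k0 k1 k2 L

def rootOK (n A : ℕ) : Bool :=
  allLt n fun i => Nat.blt (row A i) (pw n) && (!(tb (row A i) i) &&
    allLt i fun j => xnor (tb (row A i) j) (tb (row A j) i))

def checkRoot (FB : List (ℕ × ℕ)) (n A : ℕ) (E ps : List ℕ) (t : Tree) : Bool :=
  (rootOK n A && (allP FB n (fun i j => tb (row A i) j) ps &&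
    walk (killed FB ps) (indep A n) E)) && check FB t n A E

/-! ### Soundness -/

theorem beq_iff {a b : ℕ} : Nat.beq a b = true ↔ a = b := by simp

theorem blt_iff {a b : ℕ} : Nat.blt a b = true ↔ a < b := by
  simp [Nat.blt]

theorem tb_eq (m i : ℕ) : tb m i = m.testBit i := by
  have h : tb m i = Nat.beq ((m >>> i) &&& 1) 1 := rfl
  rw [h, Nat.testBit, Nat.and_one_is_mod, Nat.and_comm, Nat.and_one_is_mod]
  rcases Nat.mod_two_eq_zero_or_one (m >>> i) with h | h <;> rw [h] <;> rfl

theorem tb_lor (x y i : ℕ) : tb (Nat.lor x y) i = (tb x i || tb y i) := by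
  have h : Nat.lor x y = x ||| y := rfl
  rw [h, tb_eq, tb_eq, tb_eq, Nat.testBit_or]

theorem tb_pw (n i : ℕ) : tb (pw n) i = true ↔ i = n := by
  have h : pw n = 2 ^ n := rfl
  rw [h, tb_eq, Nat.testBit_two_pow]; simp [eq_comm]

theorem tb_zero (i : ℕ) : tb 0 i = false := by simp [tb_eq]

theorem dj_iff (x y : ℕ) : dj x y = true ↔ ∀ i, tb x i = true → tb y i = true → False := by
  have h : dj x y = Nat.beq (x &&& y) 0 := rfl
  rw [h, beq_iff]
  constructor
  · intro h i hx hy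
    rw [tb_eq] at hx hy
    have := congrArg (fun z => Nat.testBit z i) h
    simp [hx, hy] at this
  · intro h
    apply Nat.eq_of_testBit_eq
    intro i
    have := h i
    rw [tb_eq, tb_eq] at this
    rw [Nat.testBit_and]
    cases hx : x.testBit i <;> cases hy : y.testBit i <;> simp_all

theorem allLt_iff {n : ℕ} {p : ℕ → Bool} : allLt n p = true ↔ ∀ i < n, p i = true := by
  induction n with
  | zero => simp [allLt]
  | succ n ih =>
    simp only [allLt, Bool.and_eq_true, ih]
    constructor
    · rintro ⟨h1, h2⟩ i hi
      rcases Nat.lt_succ_iff_lt_or_eq.1 hi with h | rfl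
      · exact h2 i h
      · exact h1
    · intro h
      exact ⟨h n (by omega), fun i hi => h i (by omega)⟩

theorem xnor_iff {x y : Bool} : xnor x y = true ↔ x = y := by
  cases x <;> cases y <;> simp [xnor]

theorem memb_iff {j : ℕ} {L : List ℕ} : memb j L = true ↔ j ∈ L := by
  induction L with
  | nil => simp [memb]
  | cons x L ih => simp only [memb, Bool.or_eq_true, beq_iff, ih, List.mem_cons]

theorem allB_iff {p : ℕ → Bool} {L : List ℕ} : allB p L = true ↔ ∀ x ∈ L, p x = true := by
  induction L with
  | nil => simp [allB]
  | cons x L ih => simp [allB, ih]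

theorem walk_sound {q : ℕ → Bool} {cs es : List ℕ} (h : walk q cs es = true) :
    ∀ c ∈ cs, c ∈ es ∨ q c = true := by
  induction cs generalizing es with
  | nil => simp
  | cons c cs ih =>
    cases es with
    | nil =>
      simp only [walk, Bool.and_eq_true] at h
      intro d hd
      rcases List.mem_cons.1 hd with rfl | hd
      · exact Or.inr h.1
      · exact ih h.2 d hd
    | cons e es =>
      rw [walk] at h
      cases hce : Nat.beq c e with
      | true =>
        rw [hce] at h
        intro d hd
        rcases List.mem_cons.1 hd with rfl | hd
        · left; rw [beq_iff.1 hce]; simp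
        · rcases ih h d hd with h | h
          · left; simp [h]
          · exact Or.inr h
      | false =>
        rw [hce] at h
        simp only [cond_false, Bool.and_eq_true] at h
        intro d hd
        rcases List.mem_cons.1 hd with rfl | hd
        · exact Or.inr h.1
        · exact ih h.2 d hd

theorem cands_mem {n m x : ℕ} {E : List ℕ} (h : x ∈ E) : x ∈ cands n m E := by
  induction E with
  | nil => simp at h
  | cons y E ih =>
    rw [cands]
    rcases List.mem_cons.1 h with rfl | h <;> cases dj _ m <;> simp_all

theorem cands_mem_lor {n m x : ℕ} {E : List ℕ} (h : x ∈ E) (hd : dj x m = true) :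
    Nat.lor x (pw n) ∈ cands n m E := by
  induction E with
  | nil => simp at h
  | cons y E ih =>
    rw [cands]
    rcases List.mem_cons.1 h with rfl | h
    · simp [hd]
    · cases dj y m <;> simp_all

theorem cands_mem_pw {n m : ℕ} {E : List ℕ} : pw n ∈ cands n m E := by
  induction E with
  | nil => simp [cands]
  | cons y E ih => rw [cands]; cases dj y m <;> simp_all

section
variable {V : Type} {G : SimpleGraph V}

/-- No induced copy of the graph with matrix `F` on `k` vertices. -/
def NoEmb (G : SimpleGraph V) (k F : ℕ) : Prop :=
  ¬ ∃ f : ℕ → V, ∀ i < k, ∀ j < i, f i ≠ f j ∧ (tb (row F i) j = true ↔ G.Adj (f i) (f j))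

def Inj (n : ℕ) (f : ℕ → V) : Prop := ∀ i < n, ∀ j < n, f i = f j → i = j

/-- `f` embeds the state graph `A` into `G`. -/
def Emb (G : SimpleGraph V) (n A : ℕ) (f : ℕ → V) : Prop :=
  Inj n f ∧ ∀ i < n, ∀ j, tb (row A i) j = true ↔ j < n ∧ G.Adj (f i) (f j)

def Mask (G : SimpleGraph V) (n : ℕ) (f : ℕ → V) (z : V) (m : ℕ) : Prop :=
  ∀ i, tb m i = true ↔ i < n ∧ G.Adj (f i) z

def HasT (G : SimpleGraph V) (n : ℕ) (f : ℕ → V) (E : List ℕ) (z : V) : Prop :=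
  ∃ m, (m = 0 ∨ m ∈ E) ∧ Mask G n f z m

def Typed (G : SimpleGraph V) (n : ℕ) (f : ℕ → V) (E : List ℕ) : Prop :=
  ∀ z, (∀ i < n, f i ≠ z) → HasT G n f E z

def TriFree (G : SimpleGraph V) : Prop := ∀ x y z, G.Adj x y → G.Adj y z → G.Adj x z → False

def FBOK (G : SimpleGraph V) (FB : List (ℕ × ℕ)) : Prop :=
  NoEmb G 3 K3 ∧ ∀ q ∈ FB, NoEmb G q.1 q.2

theorem nthF_ok {FB : List (ℕ × ℕ)} (h : FBOK G FB) (i : ℕ) :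
    NoEmb G (nthF FB i).1 (nthF FB i).2 := by
  induction FB generalizing i with
  | nil => exact h.1
  | cons q L ih =>
    cases i with
    | zero => exact h.2 q (by simp)
    | succ i => exact ih ⟨h.1, fun q hq => h.2 q (by simp [hq])⟩ i

theorem pat_sound {FB : List (ℕ × ℕ)} (hFB : FBOK G FB) {n : ℕ} {a : ℕ → ℕ → Bool} {f : ℕ → V}
    (hinj : Inj n f) (ha : ∀ i < n, ∀ j < n, a i j = true ↔ G.Adj (f i) (f j))
    {w : V} (hw : ∀ i < n, f i ≠ w) {m : ℕ} (hm : Mask G n f w m) {p : ℕ}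
    (h1 : patOK FB n a p = true) (h2 : patKill FB p m = true) : False := by
  have hno := nthF_ok hFB (dg p 0)
  unfold patOK at h1
  unfold patKill at h2
  revert hno h1 h2
  generalize nthF FB (dg p 0) = q
  generalize dg p 1 = r
  obtain ⟨k, F⟩ := q
  simp only
  intro h1 h2 hno
  rw [allLt_iff] at h1 h2
  apply hno
  refine ⟨fun i => if i = r then w else f (dg p (i + 2)), ?_⟩
  intro i hi j hj
  dsimp only
  have hi1 := h1 i hi
  have hj1 := h1 j (by omega)
  have hi2 := h2 i hi
  have hj2 := h2 j (by omega)
  simp only [Bool.or_eq_true, Bool.and_eq_true, beq_iff, blt_iff, xnor_iff, allLt_iff,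
    Bool.not_eq_true'] at hi1 hj1 hi2 hj2
  by_cases hir : i = r
  · have hjr : j ≠ r := by omega
    have hjl := (hj1.resolve_left hjr).1
    have hjm := hj2.resolve_left hjr
    rw [if_pos hir, if_neg hjr]
    refine ⟨fun h => hw _ hjl h.symm, ?_⟩
    rw [blt_iff.2 (by omega : j < r)] at hjm
    rw [hir, ← cond_true (tb (row F r) j) (tb (row F j) r), ← hjm, hm]
    simp [hjl, G.adj_comm]
  · have hil := (hi1.resolve_left hir)
    have him := hi2.resolve_left hir
    rw [if_neg hir]
    by_cases hjr : j = r
    · rw [if_pos hjr]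
      refine ⟨fun h => hw _ hil.1 h, ?_⟩
      have : Nat.blt i r = false := by
        rw [← Bool.not_eq_true, blt_iff]; omega
      rw [this] at him
      rw [hjr, ← cond_false (tb (row F r) i) (tb (row F i) r), ← him, hm]
      simp [hil.1]
    · rw [if_neg hjr]
      have hjl := (hj1.resolve_left hjr).1
      have := (hil.2 j hj).resolve_left hjr
      constructor
      · intro h
        have := hinj _ hil.1 _ hjl h
        have h3 := this ▸ (hil.2 j hj).resolve_left hjr
        rw [← this] at h3
        simp at h3
      · rw [← this.2, ha _ hil.1 _ hjl]

theorem killed_sound {FB : List (ℕ × ℕ)} (hFB : FBOK G FB) {n : ℕ} {a : ℕ → ℕ → Bool} {f : ℕ → V}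
    (hinj : Inj n f) (ha : ∀ i < n, ∀ j < n, a i j = true ↔ G.Adj (f i) (f j))
    {w : V} (hw : ∀ i < n, f i ≠ w) {m : ℕ} (hm : Mask G n f w m) {ps : List ℕ}
    (h1 : allP FB n a ps = true) (h2 : killed FB ps m = true) : False := by
  induction ps with
  | nil => simp [killed] at h2
  | cons p ps ih =>
    simp only [allP, killed, Bool.and_eq_true, Bool.or_eq_true] at h1 h2
    rcases h2 with h2 | h2
    · exact pat_sound hFB hinj ha hw hm h1.1 h2
    · exact ih h1.2 h2

theorem mask_ext_not {n : ℕ} {f : ℕ → V} {z : V} {x : ℕ} (h : Mask G n f z x)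
    (hn : ¬ G.Adj (f n) z) : Mask G (n + 1) f z x := by
  intro i
  rw [h i]
  constructor
  · rintro ⟨h1, h2⟩; exact ⟨by omega, h2⟩
  · rintro ⟨h1, h2⟩
    refine ⟨?_, h2⟩
    rcases Nat.lt_succ_iff_lt_or_eq.1 h1 with h | rfl
    · exact h
    · exact absurd h2 hn

theorem mask_ext_adj {n : ℕ} {f : ℕ → V} {z : V} {x : ℕ} (h : Mask G n f z x)
    (hn : G.Adj (f n) z) : Mask G (n + 1) f z (Nat.lor x (pw n)) := by
  intro i
  rw [tb_lor, Bool.or_eq_true, h i, tb_pw]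
  constructor
  · rintro (⟨h1, h2⟩ | rfl)
    · exact ⟨by omega, h2⟩
    · exact ⟨by omega, hn⟩
  · rintro ⟨h1, h2⟩
    rcases Nat.lt_succ_iff_lt_or_eq.1 h1 with h | rfl
    · exact Or.inl ⟨h, h2⟩
    · exact Or.inr rfl

theorem lor_zero (m : ℕ) : Nat.lor 0 m = m := Nat.zero_or m

theorem hasT_cands (hT : TriFree G) {n M : ℕ} {f : ℕ → V} {E : List ℕ} {z : V}
    (h : HasT G n f E z) (hM : ∀ i < n, tb M i = true → G.Adj (f i) (f n)) :
    HasT G (n + 1) f (cands n M E) z := by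
  obtain ⟨x, hx, hm⟩ := h
  by_cases ha : G.Adj (f n) z
  · refine ⟨_, Or.inr ?_, mask_ext_adj hm ha⟩
    rcases hx with rfl | hx
    · rw [lor_zero]; exact cands_mem_pw
    · apply cands_mem_lor hx
      rw [dj_iff]
      intro i h1 h2
      have h3 := (hm i).1 h1
      exact hT _ _ _ (hM i h3.1 h2) ha h3.2
  · exact ⟨x, hx.imp id cands_mem, mask_ext_not hm ha⟩

theorem indep_sound (hT : TriFree G) {n A : ℕ} {f : ℕ → V} (hf : Emb G n A f) (z : V) (k : ℕ)
    (hk : k ≤ n) : HasT G k f (indep A k) z := by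
  induction k with
  | zero => exact ⟨0, Or.inl rfl, fun i => by simp [tb_zero]⟩
  | succ k ih =>
    rw [indep]
    apply hasT_cands hT (ih (by omega))
    intro i hi h
    exact (((hf.2 k (by omega) i).1 h).2).symm

theorem ext_emb {n A : ℕ} {f : ℕ → V} (hf : Emb G n A f) {z : V} (hz : ∀ i < n, f i ≠ z) :
    Inj (n + 1) (Function.update f n z) := by
  intro i hi j hj h
  simp only [Function.update_apply] at h
  split_ifs at h with h1 h2 h2
  · omega
  · exact absurd h.symm (hz j (by omega))
  · exact absurd h (hz i (by omega))
  · exact hf.1 i (by omega) j (by omega) h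

theorem mask_update {n : ℕ} {f : ℕ → V} {z w : V} {m : ℕ} :
    Mask G n (Function.update f n z) w m ↔ Mask G n f w m := by
  unfold Mask
  refine forall_congr' fun i => ?_
  by_cases h : i = n
  · simp [h]
  · rw [Function.update_of_ne h]

theorem extAdj_ok {n A m : ℕ} {f : ℕ → V} (hf : Emb G n A f) {z : V}
    (hm : Mask G n f z m) : ∀ i < n + 1, ∀ j < n + 1, extAdj n A m i j = true ↔
      G.Adj (Function.update f n z i) (Function.update f n z j) := by
  intro i hi j hj
  unfold extAdj
  by_cases h1 : i = n
  · rw [beq_iff.2 h1, cond_true, hm j, h1, Function.update_self]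
    by_cases h2 : j = n
    · simp [h2]
    · rw [Function.update_of_ne h2, G.adj_comm]
      simp only [and_iff_right_iff_imp]; omega
  · have : Nat.beq i n = false := by rw [← Bool.not_eq_true, beq_iff]; exact h1
    rw [this, cond_false, Function.update_of_ne h1]
    by_cases h2 : j = n
    · rw [beq_iff.2 h2, cond_true, hm i, h2, Function.update_self]
      simp only [and_iff_right_iff_imp]; omega
    · have : Nat.beq j n = false := by rw [← Bool.not_eq_true, beq_iff]; exact h2
      rw [this, cond_false, Function.update_of_ne h2, hf.2 i (by omega)]
      simp only [and_iff_right_iff_imp]; omega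

theorem extOK_sound {n A A' m : ℕ} {f : ℕ → V} (hf : Emb G n A f) {z : V}
    (hz : ∀ i < n, f i ≠ z) (hm : Mask G n f z m) (h : extOK n m A A' = true) :
    Emb G (n + 1) A' (Function.update f n z) := by
  refine ⟨ext_emb hf hz, ?_⟩
  intro i hi j
  simp only [extOK, Bool.and_eq_true, beq_iff, allLt_iff] at h
  by_cases h1 : i = n
  · rw [h1, h.1, hm j, Function.update_self]
    by_cases h2 : j = n
    · simp [h2]
    · rw [Function.update_of_ne h2, G.adj_comm]
      have : j < n ↔ j < n + 1 := by omega
      rw [this]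
  · have hin : i < n := by omega
    rw [h.2 i hin, Function.update_of_ne h1]
    have hmi := hm i
    cases hb : tb m i with
    | true =>
      rw [cond_true, tb_lor, Bool.or_eq_true, hf.2 i hin j, tb_pw]
      by_cases h2 : j = n
      · subst h2
        simp [(hmi.1 hb).2]
      · rw [Function.update_of_ne h2]
        have : j < n ↔ j < n + 1 := by omega
        rw [this]; simp [h2]
    | false =>
      rw [cond_false, hf.2 i hin j]
      rw [hb] at hmi
      by_cases h2 : j = n
      · subst h2
        simp only [Bool.false_eq_true, false_iff, not_and] at hmi
        simp [hmi hin]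
      · rw [Function.update_of_ne h2]
        have : j < n ↔ j < n + 1 := by omega
        rw [this]

/-- Three-colorings as functions to `ℕ`, proper on the set `T`. -/
def Col (G : SimpleGraph V) (T : Set V) (χ : V → ℕ) : Prop :=
  (∀ x, χ x < 3) ∧ ∀ x ∈ T, ∀ y ∈ T, G.Adj x y → χ x ≠ χ y

/-- What we use of minimality. -/
def Crit (G : SimpleGraph V) : Prop :=
  TriFree G ∧ (¬ ∃ χ, Col G Set.univ χ) ∧ ∀ (T : Set V) (v : V), v ∉ T → ∃ χ, Col G T χ

theorem minCol [Fintype V] (hG : MinCex G) : Crit G := by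
  classical
  obtain ⟨h3, hF, h4, hmin⟩ := hG
  refine ⟨?_, ?_, ?_⟩
  · intro x y z hxy hyz hxz
    exact h3 {x, y, z} (is3Clique_triple_iff.2 ⟨hxy, hxz, hyz⟩)
  · rintro ⟨χ, h1, h2⟩
    have hc : G.Colorable 3 :=
      ⟨Coloring.mk (fun v => (⟨χ v, h1 v⟩ : Fin 3)) (by
        intro x y hxy he
        exact h2 x trivial y trivial hxy (by simpa using he))⟩
    have := h4.trans hc.chromaticNumber_le
    norm_num at this
  · intro T v hv
    have hc : (G.induce T).chromaticNumber ≤ 3 := by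
      apply hmin
      · exact Fintype.card_subtype_lt (p := fun x => x ∈ T) hv
      · exact h3.comap ⟨(Embedding.induce T).toCopy⟩
      · exact ⟨fun e => hF.false (e.trans (Embedding.induce T))⟩
    have hc : (G.induce T).Colorable 3 := chromaticNumber_le_iff_colorable.1 hc
    obtain ⟨C⟩ := hc
    refine ⟨fun x => if h : x ∈ T then (C ⟨x, h⟩ : Fin 3).val else 0, ?_, ?_⟩
    · intro x
      dsimp only
      split_ifs
      · exact Fin.isLt _
      · norm_num
    · intro x hx y hy hxy
      simp only [hx, hy, dite_true]
      intro he
      exact C.valid (v := ⟨x, hx⟩) (w := ⟨y, hy⟩) (by simpa using hxy) (Fin.ext he)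

/-! #### Extension rule -/

theorem okc_sound {A v c d : ℕ} {E : List ℕ} (h : okc A E v c d = true) :
    (∀ j, tb (row A v) j = true → tb c j = true → False) ∧
      ∀ m ∈ E, tb m v = true → ∃ j, tb m j = true ∧ tb d j = true := by
  simp only [okc, Bool.and_eq_true, dj_iff, allB_iff, Bool.or_eq_true, Bool.not_eq_true'] at h
  refine ⟨h.1, fun m hm hv => ?_⟩
  rcases h.2 m hm with h | h
  · simp [hv] at h
  · by_contra hcon
    push Not at hcon
    rw [← Bool.not_eq_true, dj_iff] at h
    exact h fun i h1 h2 => hcon i h1 h2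

/-- `x` is not one of the vertices of `R`. -/
def Off (f : ℕ → V) (R : List ℕ) : Set V := {x | ∀ r ∈ R, f r ≠ x}

theorem col_step [DecidableEq V] {n A : ℕ} {f : ℕ → V} {E R0 R Q : List ℕ} (hf : Emb G n A f)
    (hE : Typed G n f E) {χ : V → ℕ} {v k c d : ℕ} (hk : k < 3) (hv : v < n) (hvQ : v ∉ Q)
    (hrow : ∀ j, tb (row A v) j = true → j ∈ R0 ∨ j ∈ Q)
    (hc : ∀ j, j < n → (j ∈ Q ∨ (j ∈ R0 ∧ j ∉ v :: R)) → χ (f j) = k → tb c j = true)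
    (hd : ∀ j, tb d j = true → j < n ∧ j ∈ Q ∧ χ (f j) = k)
    (hQR : ∀ j ∈ Q, j ∉ v :: R) (hRn : ∀ j ∈ v :: R, j < n)
    (hok : okc A E v c d = true)
    (hχ : Col G (Off f (v :: R)) χ) : Col G (Off f R) (Function.update χ (f v) k) := by
  obtain ⟨h1, h2⟩ := okc_sound hok
  have key : ∀ y ∈ Off f R, y ≠ f v → G.Adj (f v) y → χ y ≠ k := by
    intro y hy hyv hadj hyk
    by_cases hout : ∀ i < n, f i ≠ y
    · obtain ⟨m, hm0, hm⟩ := hE y hout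
      have hmv := (hm v).2 ⟨hv, hadj⟩
      have hmE : m ∈ E := by
        rcases hm0 with rfl | h
        · simp [tb_zero] at hmv
        · exact h
      obtain ⟨j, hj1, hj2⟩ := h2 m hmE hmv
      obtain ⟨hjn, hjQ, hjk⟩ := hd j hj2
      have hja := ((hm j).1 hj1).2
      refine hχ.2 (f j) ?_ y ?_ hja (hjk.trans hyk.symm)
      · intro r hr he
        have := hf.1 r (hRn r hr) j hjn he
        exact hQR j hjQ (this ▸ hr)
      · intro r hr he
        rcases List.mem_cons.1 hr with rfl | hr
        · exact hyv he.symm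
        · exact hy r hr he
    · push Not at hout
      obtain ⟨j, hj, rfl⟩ := hout
      have hrj := (hf.2 v hv j).2 ⟨hj, hadj⟩
      have hjv : j ≠ v := fun h => hyv (by rw [h])
      have hjR : j ∉ v :: R := by
        intro h
        rcases List.mem_cons.1 h with h | h
        · exact hjv h
        · exact hy j h rfl
      refine h1 j hrj (hc j hj ?_ hyk)
      rcases hrow j hrj with h | h
      · exact Or.inr ⟨h, hjR⟩
      · exact Or.inl h
  refine ⟨?_, ?_⟩
  · intro x
    rw [Function.update_apply]
    split_ifs
    · exact hk
    · exact hχ.1 x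
  · intro x hx y hy hxy
    rw [Function.update_apply, Function.update_apply]
    split_ifs with h3 h4 h4
    · exact absurd (h3.trans h4.symm) hxy.ne
    · exact (key y hy h4 (h3 ▸ hxy)).symm
    · exact key x hx h3 (h4 ▸ hxy.symm)
    · refine hχ.2 x ?_ y ?_ hxy
      · intro r hr
        rcases List.mem_cons.1 hr with rfl | hr
        · exact fun h => h3 h.symm
        · exact hx r hr
      · intro r hr
        rcases List.mem_cons.1 hr with rfl | hr
        · exact fun h => h4 h.symm
        · exact hy r hr

theorem colR_sound [DecidableEq V] {n A : ℕ} {f : ℕ → V} {E R0 Q : List ℕ} (hf : Emb G n A f)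
    (hE : Typed G n f E) (d : ℕ → ℕ)
    (hR0 : ∀ j ∈ R0, j < n) (hQR : ∀ j ∈ Q, j ∉ R0)
    (hrow : ∀ v ∈ R0, ∀ j, tb (row A v) j = true → j ∈ R0 ∨ j ∈ Q) (R : List ℕ) :
    ∀ (χ : V → ℕ) (c : ℕ → ℕ), (∀ j ∈ R, j ∈ R0) →
    (∀ k < 3, ∀ j, j < n → (j ∈ Q ∨ (j ∈ R0 ∧ j ∉ R)) → χ (f j) = k → tb (c k) j = true) →
    (∀ k < 3, ∀ j, tb (d k) j = true → j < n ∧ j ∈ Q ∧ χ (f j) = k) →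
    colR A E (d 0) (d 1) (d 2) R (c 0) (c 1) (c 2) = true →
    Col G (Off f R) χ → ∃ χ', Col G Set.univ χ' := by
  induction R with
  | nil =>
    intro χ c _ _ _ _ h
    refine ⟨χ, h.1, fun x _ y _ hxy => h.2 x ?_ y ?_ hxy⟩ <;> intro r hr <;> simp at hr
  | cons v R ih =>
    intro χ c hR hc hd h hχ
    have hvR := hR v (by simp)
    have hvn := hR0 v hvR
    have hvQ : v ∉ Q := fun h => hQR v h hvR
    -- one color works
    have main : ∀ k < 3, okc A E v (c k) (d k) = true →
        colR A E (d 0) (d 1) (d 2) R (Function.update c k (Nat.lor (c k) (pw v)) 0)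
          (Function.update c k (Nat.lor (c k) (pw v)) 1)
          (Function.update c k (Nat.lor (c k) (pw v)) 2) = true →
        ∃ χ', Col G Set.univ χ' := by
      intro k hk hok hrec
      refine ih (Function.update χ (f v) k) _ (fun j hj => hR j (by simp [hj])) ?_ ?_ hrec
        (col_step hf hE hk hvn hvQ (hrow v hvR) (hc k hk) (hd k hk)
          (fun j hj hj' => hQR j hj (hR j hj')) (fun j hj => hR0 j (hR j hj)) hok hχ)
      · intro l hl j hjn hj hjl
        by_cases hjv : j = v
        · subst hjv
          rw [Function.update_self] at hjl
          subst hjl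
          rw [Function.update_self, tb_lor, (tb_pw j j).2 rfl, Bool.or_true]
        · have hfj : f j ≠ f v := fun he => hjv (hf.1 j hjn v hvn he)
          rw [Function.update_of_ne hfj] at hjl
          have h1 := hc l hl j hjn (by simpa [hjv] using hj) hjl
          by_cases hlk : l = k
          · subst hlk
            rw [Function.update_self, tb_lor, h1, Bool.true_or]
          · rw [Function.update_of_ne hlk, h1]
      · intro l hl j hj
        obtain ⟨h1, h2, h3⟩ := hd l hl j hj
        refine ⟨h1, h2, ?_⟩
        have hjv : j ≠ v := fun h => hvQ (h ▸ h2)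
        rw [Function.update_of_ne (fun he => hjv (hf.1 j h1 v hvn he)), h3]
    simp only [colR, Bool.or_eq_true, Bool.and_eq_true] at h
    rcases h with h | h | h
    · exact main 0 (by norm_num) h.1 h.2
    · exact main 1 (by norm_num) h.1 h.2
    · exact main 2 (by norm_num) h.1 h.2

theorem colQ_sound [DecidableEq V] {n A : ℕ} {f : ℕ → V} {E R Q0 : List ℕ} (hf : Emb G n A f)
    (hE : Typed G n f E)
    (hQn : ∀ j ∈ Q0, j < n) (hR0 : ∀ j ∈ R, j < n) (hQR : ∀ j ∈ Q0, j ∉ R)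
    (hrow : ∀ v ∈ R, ∀ j, tb (row A v) j = true → j ∈ R ∨ j ∈ Q0)
    (χ : V → ℕ) (hχ : Col G (Off f R) χ) (Q : List ℕ) :
    ∀ (D : List ℕ) (c : ℕ → ℕ), (∀ j, j ∈ Q0 ↔ j ∈ D ∨ j ∈ Q) →
    (∀ k < 3, ∀ j, tb (c k) j = true ↔ j ∈ D ∧ χ (f j) = k) →
    colQ A E R Q (c 0) (c 1) (c 2) = true → ∃ χ', Col G Set.univ χ' := by
  induction Q with
  | nil =>
    intro D c hD hc h
    rw [colQ] at h
    refine colR_sound hf hE c hR0 hQR hrow R χ c (fun j hj => hj) ?_ ?_ h hχ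
    · intro k hk j _ hj hjk
      rw [hc k hk]
      refine ⟨?_, hjk⟩
      rcases hj with hj | hj
      · simpa using (hD j).1 hj
      · exact absurd hj.1 hj.2
    · intro k hk j hj
      have := (hc k hk j).1 hj
      have h2 := (hD j).2 (Or.inl this.1)
      exact ⟨hQn j h2, h2, this.2⟩
  | cons v Q ih =>
    intro D c hD hc h
    have hvQ : v ∈ Q0 := (hD v).2 (Or.inr (by simp))
    have hoff : ∀ j ∈ Q0, f j ∈ Off f R := by
      intro j hj r hr he
      have := hf.1 r (hR0 r hr) j (hQn j hj) he
      exact hQR j hj (this ▸ hr)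
    have main : ∀ k < 3, χ (f v) = k → (dj (row A v) (c k) = false ∨
        colQ A E R Q (Function.update c k (Nat.lor (c k) (pw v)) 0)
          (Function.update c k (Nat.lor (c k) (pw v)) 1)
          (Function.update c k (Nat.lor (c k) (pw v)) 2) = true) →
        ∃ χ', Col G Set.univ χ' := by
      intro k hk hvk hor
      rcases hor with hdj | hrec
      · exfalso
        rw [← Bool.not_eq_true, dj_iff] at hdj
        apply hdj
        intro j h1 h2
        have h3 := (hf.2 v (hQn v hvQ) j).1 h1
        have h4 := (hc k hk j).1 h2
        exact hχ.2 _ (hoff v hvQ) _ (hoff j ((hD j).2 (Or.inl h4.1))) h3.2 (hvk.trans h4.2.symm)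
      · refine ih (v :: D) _ ?_ ?_ hrec
        · intro j
          rw [hD j, List.mem_cons, List.mem_cons]
          tauto
        · intro l hl j
          by_cases hlk : l = k
          · subst hlk
            rw [Function.update_self, tb_lor, Bool.or_eq_true, hc l hl, tb_pw, List.mem_cons]
            constructor
            · rintro (h | rfl)
              · exact ⟨Or.inr h.1, h.2⟩
              · exact ⟨Or.inl rfl, hvk⟩
            · rintro ⟨h1 | h1, h2⟩
              · exact Or.inr h1
              · exact Or.inl ⟨h1, h2⟩
          · rw [Function.update_of_ne hlk, hc l hl, List.mem_cons]
            constructor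
            · rintro h
              exact ⟨Or.inr h.1, h.2⟩
            · rintro ⟨h1 | h1, h2⟩
              · subst h1
                exact absurd (h2.symm.trans hvk) hlk
              · exact ⟨h1, h2⟩
    simp only [colQ, Bool.or_eq_true, Bool.and_eq_true, Bool.not_eq_true'] at h
    have h3 := hχ.1 (f v)
    have h4 : χ (f v) = 0 ∨ χ (f v) = 1 ∨ χ (f v) = 2 := by omega
    rcases h4 with h4 | h4 | h4
    · exact main 0 (by norm_num) h4 h.1
    · exact main 1 (by norm_num) h4 h.2.1
    · exact main 2 (by norm_num) h4 h.2.2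

theorem checkE_sound (hG : Crit G) {n A : ℕ} {f : ℕ → V} {E R Q : List ℕ} (hf : Emb G n A f)
    (hE : Typed G n f E) (h : checkE n A E R Q = true) : False := by
  classical
  unfold checkE at h
  cases R with
  | nil => simp at h
  | cons r R =>
    simp only at h
    generalize hR : r :: R = R0 at h
    have hr : r ∈ R0 := by simp [← hR]
    simp only [Bool.and_eq_true, allB_iff, blt_iff, allLt_iff, Bool.or_eq_true,
      Bool.not_eq_true', memb_iff] at h
    obtain ⟨h1, h2, h3⟩ := h
    obtain ⟨χ, hχ⟩ := hG.2.2 (Off f R0) (f r) (fun h => h r hr rfl)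
    apply hG.2.1
    refine colQ_sound (Q0 := Q) hf hE (fun j hj => (h2 j hj).1) (fun j hj => (h1 j hj).1) ?_ ?_ χ hχ Q []
      (fun _ => 0) (by simp) (by simp [tb_zero]) h3
    · intro j hj hj'
      have := (h2 j hj).2
      rw [← Bool.not_eq_true, memb_iff] at this
      exact this hj'
    · intro v hv j hj
      have hj2 := (hf.2 v (h1 v hv).1 j).1 hj
      rcases (h1 v hv).2 j hj2.1 with (h | h) | h
      · simp [hj] at h
      · exact Or.inl h
      · exact Or.inr h

/-! #### Coloring rule -/

theorem pairOK_sound {FB : List (ℕ × ℕ)} {n m c : ℕ} {ps : List ℕ} {L : List (ℕ × ℕ × List ℕ)}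
    (h : pairOK FB n m c ps L = true) : ∀ e ∈ L, c = e.2.1 → dj m e.1 = true →
      killed FB ps (Nat.lor e.1 (pw n)) = true := by
  induction L with
  | nil => simp
  | cons e L ih =>
    obtain ⟨m', c', p'⟩ := e
    simp only [pairOK, Bool.and_eq_true, Bool.or_eq_true, Bool.not_eq_true'] at h
    intro e he hc hd
    rcases List.mem_cons.1 he with rfl | he
    · rcases h.1 with h | h | h
      · rw [← Bool.not_eq_true, beq_iff] at h; exact absurd hc h
      · rw [hd] at h; simp at h
      · exact h
    · exact ih h.2 e he hc hd

/-- Conclusions for a single entry and for pairs of entries. -/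
def EntOK (G : SimpleGraph V) (n : ℕ) (f : ℕ → V) (k0 k1 k2 : ℕ) (e : ℕ × ℕ × List ℕ) : Prop :=
  e.2.1 < 3 ∧ dj e.1 (sel e.2.1 k0 k1 k2) = true ∧
    ∀ z w, (∀ i < n, f i ≠ z) → (∀ i < n, f i ≠ w) → Mask G n f z e.1 → Mask G n f w 0 →
      ¬ G.Adj z w

def PairOK (G : SimpleGraph V) (n : ℕ) (f : ℕ → V) (e e' : ℕ × ℕ × List ℕ) : Prop :=
  e.2.1 = e'.2.1 → ∀ z w, (∀ i < n, f i ≠ z) → (∀ i < n, f i ≠ w) → Mask G n f z e.1 →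
    Mask G n f w e'.1 → ¬ G.Adj z w

theorem kill_ext {FB : List (ℕ × ℕ)} (hFB : FBOK G FB) {n A m x : ℕ} {f : ℕ → V}
    (hf : Emb G n A f) {z w : V} (hz : ∀ i < n, f i ≠ z) (hw : ∀ i < n, f i ≠ w)
    (hm : Mask G n f z m) (hx : Mask G n f w x) (hzw : G.Adj z w) {ps : List ℕ}
    (h1 : allP FB (n + 1) (extAdj n A m) ps = true)
    (h2 : killed FB ps (Nat.lor x (pw n)) = true) : False := by
  refine killed_sound hFB (ext_emb hf hz) (extAdj_ok hf hm) (w := w) ?_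
    (mask_ext_adj (mask_update.2 hx) ?_) h1 h2
  · intro i hi
    by_cases h : i = n
    · rw [h, Function.update_self]; exact hzw.ne
    · rw [Function.update_of_ne h]; exact hw i (by omega)
  · rw [Function.update_self]; exact hzw

theorem entries_sound (hT : TriFree G) {FB : List (ℕ × ℕ)} (hFB : FBOK G FB) {n A k0 k1 k2 : ℕ}
    {f : ℕ → V} (hf : Emb G n A f) {E : List ℕ} {L : List (ℕ × ℕ × List ℕ)}
    (h : entries FB n A k0 k1 k2 E L = true) :
    ∃ L' : List (ℕ × ℕ × List ℕ), (∀ m ∈ E, ∃ e ∈ L', e.1 = m) ∧ (∀ e ∈ L', e ∈ L) ∧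
      (∀ e ∈ L', EntOK G n f k0 k1 k2 e) ∧
      ∀ e ∈ L', ∀ e' ∈ L', PairOK G n f e e' := by
  induction E generalizing L with
  | nil => exact ⟨[], by simp⟩
  | cons m0 E ih =>
    cases L with
    | nil => simp [entries] at h
    | cons e L =>
      obtain ⟨m, c, ps⟩ := e
      simp only [entries, Bool.and_eq_true, beq_iff, blt_iff] at h
      obtain ⟨⟨rfl, hc, hd⟩, ⟨h1, h2, h3⟩, h4⟩ := h
      obtain ⟨L', i1, i2, i3, i4⟩ := ih h4
      have hp := pairOK_sound h3
      have key : ∀ e' ∈ (m0, c, ps) :: L, PairOK G n f (m0, c, ps) e' := by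
        intro e' he' hce z w hz hw hmz hmw hzw
        have hdj : dj m0 e'.1 = true := by
          rw [dj_iff]
          intro i a1 a2
          exact hT _ _ _ ((hmz i).1 a1).2 hzw ((hmw i).1 a2).2
        exact kill_ext hFB hf hz hw hmz hmw hzw h1 (hp e' he' hce hdj)
      refine ⟨(m0, c, ps) :: L', ?_, ?_, ?_, ?_⟩
      · intro x hx
        rcases List.mem_cons.1 hx with rfl | hx
        · exact ⟨_, List.mem_cons_self, rfl⟩
        · obtain ⟨e, he, h⟩ := i1 x hx
          exact ⟨e, List.mem_cons_of_mem _ he, h⟩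
      · intro x hx
        rcases List.mem_cons.1 hx with rfl | hx
        · exact List.mem_cons_self
        · exact List.mem_cons_of_mem _ (i2 x hx)
      · intro x hx
        rcases List.mem_cons.1 hx with rfl | hx
        · refine ⟨hc, hd, ?_⟩
          intro z w hz hw hmz hmw hzw
          refine kill_ext hFB hf hz hw hmz hmw hzw h1 ?_
          rw [lor_zero]; exact h2
        · exact i3 x hx
      · intro x hx y hy
        rcases List.mem_cons.1 hx with rfl | hx
        · rcases List.mem_cons.1 hy with rfl | hy
          · exact key _ List.mem_cons_self
          · exact key _ (List.mem_cons_of_mem _ (i2 y hy))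
        · rcases List.mem_cons.1 hy with rfl | hy
          · intro hce z w hz hw hmz hmw hzw
            exact key _ (List.mem_cons_of_mem _ (i2 x hx)) hce.symm w z hw hz hmw hmz hzw.symm
          · exact i4 x hx y hy

theorem checkB_sound (hG : Crit G) {FB : List (ℕ × ℕ)} (hFB : FBOK G FB) {n A k0 k1 k2 : ℕ}
    {f : ℕ → V} (hf : Emb G n A f) {E : List ℕ} {L : List (ℕ × ℕ × List ℕ)}
    (hE : Typed G n f E) (h : checkB FB n A E k0 k1 k2 L = true) : False := by
  classical
  simp only [checkB, Bool.and_eq_true, blt_iff, allLt_iff] at h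
  obtain ⟨⟨hn, hK⟩, hL⟩ := h
  obtain ⟨L', i1, -, i3, i4⟩ := entries_sound hG.1 hFB hf hL
  -- the vertices outside without neighbours in the state
  obtain ⟨χ, hχ⟩ := hG.2.2 {z | (∀ i < n, f i ≠ z) ∧ Mask G n f z 0} (f 0)
    (fun h => h.1 0 hn rfl)
  have hclass : ∀ x : V, ∃ k < 3, (∃ i < n, f i = x ∧ k = colOf k0 k1 i) ∨
      ((∀ i < n, f i ≠ x) ∧ Mask G n f x 0 ∧ k = χ x) ∨
      ((∀ i < n, f i ≠ x) ∧ ∃ e ∈ L', Mask G n f x e.1 ∧ k = e.2.1) := by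
    intro x
    by_cases hx : ∀ i < n, f i ≠ x
    · obtain ⟨m, rfl | hm, hmask⟩ := hE x hx
      · exact ⟨χ x, hχ.1 x, Or.inr (Or.inl ⟨hx, hmask, rfl⟩)⟩
      · obtain ⟨e, he, rfl⟩ := i1 m hm
        exact ⟨e.2.1, (i3 e he).1, Or.inr (Or.inr ⟨hx, e, he, hmask, rfl⟩)⟩
    · push Not at hx
      obtain ⟨i, hi, rfl⟩ := hx
      refine ⟨colOf k0 k1 i, ?_, Or.inl ⟨i, hi, rfl, rfl⟩⟩
      unfold colOf
      cases tb k0 i <;> cases tb k1 i <;> simp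
  choose κ hκ hcl using hclass
  apply hG.2.1
  refine ⟨κ, hκ, ?_⟩
  intro x _ y _ hxy he
  -- inner vertex against anything
  have inner : ∀ i < n, ∀ y, G.Adj (f i) y → κ y = colOf k0 k1 i → False := by
    intro i hi y hxy hk
    have hKi := hK i hi
    rcases hcl y with ⟨j, hj, rfl, hkj⟩ | ⟨hy, hm, -⟩ | ⟨hy, e, he, hm, hke⟩
    · have hKj := hK j hj
      rw [← hkj, hk] at hKj
      exact (dj_iff _ _).1 hKi.2 j ((hf.2 i hi j).2 ⟨hj, hxy⟩) hKj.1
    · have := (hm i).2 ⟨hi, hxy⟩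
      simp [tb_zero] at this
    · have h5 := (dj_iff _ _).1 (i3 e he).2.1 i ((hm i).2 ⟨hi, hxy⟩)
      rw [← hke, hk] at h5
      exact h5 hKi.1
  rcases hcl x with ⟨i, hi, rfl, hki⟩ | ⟨hx, hm, hkx⟩ | ⟨hx, e, he1, hm, hke⟩
  · exact inner i hi y hxy (he.symm.trans hki)
  · rcases hcl y with ⟨j, hj, rfl, hkj⟩ | ⟨hy, hm', hky⟩ | ⟨hy, e', he', hm', hke'⟩
    · exact inner j hj x hxy.symm (he.trans hkj)
    · exact hχ.2 x ⟨hx, hm⟩ y ⟨hy, hm'⟩ hxy (hkx.symm.trans (he.trans hky))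
    · exact (i3 e' he').2.2 y x hy hx hm' hm hxy.symm
  · rcases hcl y with ⟨j, hj, rfl, hkj⟩ | ⟨hy, hm', hky⟩ | ⟨hy, e', he', hm', hke'⟩
    · exact inner j hj x hxy.symm (he.trans hkj)
    · exact (i3 e he1).2.2 x y hx hy hm hm' hxy
    · exact i4 e he1 e' he' (hke.symm.trans (he.trans hke')) x y hx hy hm hm' hxy

/-! #### Main soundness -/

theorem typed_walk {FB : List (ℕ × ℕ)} (hFB : FBOK G FB) {n A : ℕ} {f : ℕ → V}
    (hf : Emb G n A f) {cs es ps : List ℕ} (hT : Typed G n f cs)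
    (h1 : allP FB n (fun i j => tb (row A i) j) ps = true)
    (h2 : walk (killed FB ps) cs es = true) : Typed G n f es := by
  intro z hz
  obtain ⟨m, hm, hmask⟩ := hT z hz
  refine ⟨m, ?_, hmask⟩
  rcases hm with h | h
  · exact Or.inl h
  · rcases walk_sound h2 m h with h | h
    · exact Or.inr h
    · refine (killed_sound hFB hf.1 ?_ hz hmask h1 h).elim
      intro i hi j hj
      rw [hf.2 i hi j]; simp [hj]

theorem check_sound (hG : Crit G) {FB : List (ℕ × ℕ)} (hFB : FBOK G FB) (t : Tree) :
    ∀ (n A : ℕ) (f : ℕ → V) (E : List ℕ), Emb G n A f → Typed G n f E →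
      check FB t n A E = true → False := by
  induction t with
  | ext R Q =>
    intro n A f E hf hE h
    exact checkE_sound hG hf hE h
  | col k0 k1 k2 L =>
    intro n A f E hf hE h
    exact checkB_sound hG hFB hf hE h
  | split m A' E' ps Er sub rest ih1 ih2 =>
    intro n A f E hf hE h
    simp only [check, Bool.and_eq_true] at h
    obtain ⟨⟨h1, h2, h3, h4⟩, h5, h6⟩ := h
    refine ih2 n A f Er hf ?_ h6
    intro z hz
    obtain ⟨x, hx, hm⟩ := hE z hz
    refine ⟨x, ?_, hm⟩
    rcases hx with h | h
    · exact Or.inl h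
    · rcases walk_sound h4 x h with h | h
      · exact Or.inr h
      · exfalso
        rw [beq_iff] at h
        subst h
        have hf' := extOK_sound hf hz hm h1
        refine ih1 (n + 1) A' _ E' hf' (typed_walk hFB hf' ?_ h2 h3) h5
        intro w hw
        have hw' : ∀ i < n, f i ≠ w := by
          intro i hi
          have := hw i (by omega)
          rwa [Function.update_of_ne (by omega)] at this
        obtain ⟨y, hy, hym⟩ := hE w hw'
        apply hasT_cands hG.1 ⟨y, hy, mask_update.2 hym⟩
        intro i hi hi2
        rw [Function.update_self, Function.update_of_ne (by omega)]
        exact ((hm i).1 hi2).2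

theorem root_sound (hG : Crit G) {FB : List (ℕ × ℕ)} (hFB : FBOK G FB) {n A : ℕ} {E ps : List ℕ}
    {t : Tree} (h : checkRoot FB n A E ps t = true) : NoEmb G n A := by
  rintro ⟨f, hf0⟩
  simp only [checkRoot, rootOK, Bool.and_eq_true, allLt_iff, blt_iff, Bool.not_eq_true',
    xnor_iff] at h
  obtain ⟨⟨h1, h2, h3⟩, h4⟩ := h
  have hf : Emb G n A f := by
    constructor
    · intro i hi j hj he
      rcases lt_trichotomy i j with h | h | h
      · exact absurd he.symm (hf0 j hj i h).1
      · exact h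
      · exact absurd he (hf0 i hi j h).1
    · intro i hi j
      by_cases hj : j < n
      · simp only [hj, true_and]
        rcases lt_trichotomy i j with h | h | h
        · rw [← (h1 j hj).2.2 i h, (hf0 j hj i h).2, G.adj_comm]
        · subst h
          simp [(h1 i hi).2.1]
        · exact (hf0 i hi j h).2
      · simp only [hj, false_and, iff_false, Bool.not_eq_true]
        rw [tb_eq]
        apply Nat.testBit_lt_two_pow
        exact lt_of_lt_of_le (h1 i hi).1 (Nat.pow_le_pow_right (by norm_num) (by omega))
  exact check_sound hG hFB t n A f E hf
    (typed_walk hFB hf (fun z _ => indep_sound hG.1 hf z n le_rfl) h2 h3) h4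

end

/-! ### The certificates -/

def FB0 : List (ℕ × ℕ) := [(3, K3), (7, 2535379780782312491558337839150)]

def mat013 : ℕ := 32667605715728732490591706523698960072818

def tree013 : Tree :=
  (.split 276 6155212566972031236289651527489444478248616050 [385, 389, 66, 578, 546, 98, 610, 402, 82, 114, 522, 586, 554, 618, 276, 392, 608, 384]
   [36792448033, 31677035073, 39729909825, 13044745553, 30066422353, 23641213217, 31679124033, 40818996513, 13044745809, 30082151505, 40819437569]
   [385, 393, 389, 66, 34, 98, 18, 402, 82, 50, 114, 10, 394, 74, 42, 106, 388, 20, 148, 404, 52, 8, 392, 16, 400, 48, 96, 384]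
  (.ext [7] [5, 6, 8])
 (.ext [8] [5, 6, 7])
)

def FB1 : List (ℕ × ℕ) := FB0 ++ [(9, mat013)]

theorem chk013 : checkRoot FB0 9 mat013
    [385, 393, 389, 66, 34, 98, 18, 402, 82, 50, 114, 10, 394, 74, 42, 106, 388, 20, 276, 148, 404, 52, 8, 392, 16, 400, 48, 96, 384]
    [31745643041, 31441567777, 13960106049, 1932002913, 2200372833, 35736535073, 36040610337, 12902233425, 17199298129, 1946691169, 2215061089, 1397100641, 1665470561, 12902233681]
    tree013 = true := by
  decide +kernel

def mat113 : ℕ := 32667605715728737326294984982353097850994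

def tree113 : Tree :=
  (.split 265 5909904369788194381737584885179918405582783090 [265, 389, 578, 546, 98, 610, 530, 626, 394, 106, 532, 148, 528, 400, 608, 384]
   [36794549025, 31411736641, 15302283329, 31408603201, 30084252497, 31677038657, 40821093665, 17339721041, 40821538817, 2538868833, 30082087249]
   [9, 137, 393, 389, 66, 34, 98, 18, 402, 114, 10, 394, 106, 20, 276, 148, 404, 8, 392, 16, 400, 96, 384]
  (.col 389 106 528 [
    (265, 2, [2807304289]),
    (389, 1, [2739212385, 17199299153]),
    (578, 0, [2737243745]),
    (546, 0, [2737243489]),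
    (98, 0, [2737243489]),
    (610, 0, [2737243489]),
    (530, 0, [2721581409]),
    (626, 0, [2737243489]),
    (394, 2, [23424145953]),
    (106, 0, [2751931745]),
    (532, 1, [2807239265]),
    (148, 1, [2824016481]),
    (528, 1, [2701670753]),
    (400, 1, [2744539233]),
    (608, 0, [2737243489]),
    (384, 2, [2744539233])])
 (.split 137 3055234762462867090697551444289537188053713522 [137, 389, 578, 546, 98, 610, 530, 626, 394, 106, 532, 276, 528, 400, 608, 384]
   [35706703937, 15302283329, 35703570497, 32499581729, 34379219793, 35972005953, 40552662305, 17338738001, 40553168897, 2555646049, 34376989009]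
   [9, 393, 389, 66, 34, 98, 18, 402, 114, 10, 394, 106, 20, 276, 148, 404, 8, 392, 16, 400, 96, 384]
  (.col 389 106 528 [
    (137, 2, [2824081505]),
    (389, 1, [2739212385, 17199299153]),
    (578, 0, [2737243745]),
    (546, 0, [2737243489]),
    (98, 0, [2737243489]),
    (610, 0, [2737243489]),
    (530, 0, [2721515873]),
    (626, 0, [2737243489]),
    (394, 2, [23424145953]),
    (106, 0, [2751931745]),
    (532, 1, [2807239265]),
    (276, 1, [2807239265]),
    (528, 1, [2701605217]),
    (400, 1, [2744538977]),
    (608, 0, [2737243489]),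
    (384, 2, [2744538977])])
 (.split 276 6155212566972031236294487230767903132386394226 [521, 389, 578, 546, 98, 610, 402, 114, 522, 618, 276, 520, 392, 608, 384]
   [36792448033, 39729909825, 31408599617, 31410688577, 30082151505, 31677035073, 40818996513, 13044745553, 40819437569, 2538803809]
   [9, 393, 389, 66, 34, 98, 18, 402, 114, 10, 394, 106, 20, 148, 404, 8, 392, 16, 400, 96, 384]
  (.ext [7] [5, 6, 8])
 (.ext [8] [5, 6, 7])
)))

def FB2 : List (ℕ × ℕ) := FB1 ++ [(9, mat113)]

theorem chk113 : checkRoot FB1 9 mat113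
    [9, 265, 137, 393, 389, 66, 34, 98, 18, 402, 114, 10, 394, 106, 20, 276, 148, 404, 8, 392, 16, 400, 96, 384]
    [31461478433, 13960106049, 35772174881, 1932002657, 2200372577, 12902233425, 17199297873, 1946690913, 2215060833, 35756445729, 31477207585, 1397100641, 1665470561, 12902233681, 17199298129, 9300285067298, 9300269339170, 9304311599138, 9304295871010, 9298674585682, 9298658726482]
    tree113 = true := by
  decide +kernel

def mat121 : ℕ := 21778569974575309660514251563965597679730

def tree121 : Tree :=
  (.split 133 2966020892633003444703742790321412365477020274 [133, 546, 530, 50, 562, 626, 266, 554, 404, 84, 400, 80, 592, 560, 112, 624, 384]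
   [14497173569, 35972005953, 35975139393, 1397297249, 4453840465, 2470776929, 34427316561, 521103609987]
   [386, 34, 18, 50, 114, 266, 42, 404, 84, 400, 80, 48, 112, 96, 384]
  (.col 389 554 80 [
    (133, 1, [2739212385]),
    (546, 0, [2737243489]),
    (530, 0, [2737244513]),
    (50, 0, [2737243489]),
    (562, 0, [2737243489]),
    (626, 0, [2737243489]),
    (266, 2, [2770748257]),
    (554, 2, [2751931745]),
    (404, 1, [2788495969]),
    (84, 1, [2807239265, 9302933785170]),
    (400, 1, [23408445985]),
    (80, 0, [2701604449]),
    (592, 0, [2701604449]),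
    (560, 0, [2737243489]),
    (112, 0, [2737243489]),
    (624, 0, [2737243489]),
    (384, 1, [2741589857])])
 (.split 386 8608283652433114620005572761100450692824629362 [608, 512]
   [40586183969, 6767531809, 17215027537, 32547807521, 40886089249, 32533119265, 17271626065, 650740303490]
   [34, 18, 50, 114, 266, 42, 404, 84, 400, 80, 48, 112, 96, 384]
  (.ext [4] [0, 3])
 (.split 18 401435192143525791857312887892200212029309042 [34, 18, 50, 114, 80, 48, 112, 96, 384, 896, 512]
   [31830582049, 34444227665, 31559004705, 38707594577]
   [34, 50, 114, 266, 42, 404, 84, 400, 80, 48, 112, 96, 384]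
  (.ext [8] [6, 7])
 (.split 80 1784081394452464991451734724137246519869112434 [34, 50, 114, 266, 778, 42, 554, 84, 80, 48, 112, 96, 896]
   [1896429153, 2453079649]
   [34, 50, 114, 266, 42, 404, 84, 400, 48, 112, 96, 384]
  (.col 901 42 80 [
    (34, 0, [2737243489]),
    (50, 0, [2737243489]),
    (114, 0, [2737243489]),
    (266, 2, [2770748257]),
    (778, 2, [2770748257]),
    (42, 0, [2751931745]),
    (554, 2, [2751931745]),
    (84, 1, [2807239265]),
    (80, 1, [2701604449]),
    (48, 0, [2737243489]),
    (112, 0, [2737243489]),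
    (96, 0, [2737243489]),
    (896, 2, [19687049761])])
 (.split 112 2497705240805444932599847728504684225510047858 [34, 50, 114, 266, 778, 42, 84, 48, 112, 896]
   [1896429153, 19614692641, 2468808033]
   [34, 50, 114, 266, 42, 404, 84, 400, 48, 96, 384]
  (.ext [7] [5, 6, 9])
 (.split 266 5932194225950983851451454822719148379622146162 [114, 266, 596, 560, 384]
   [36842774817, 1226199137, 31680176961, 40869328417, 8749778513, 2502312801, 38722282833]
   [34, 50, 114, 42, 404, 84, 400, 48, 96, 384]
  (.split 560 818469685062614880536013128310381153389637450137714 [114, 1290, 596, 1408]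
    [45466263841, 27667768609, 1932133729, 2737243489]
    [114, 266, 596, 384]
   (.col 1413 42 592 [
     (114, 0, [3005678945]),
     (1290, 2, [3039183713]),
     (596, 1, [3075674721, 30069566289]),
     (1408, 1, [2979351137])])
  (.ext [4] [0, 3, 6])
) (.ext [1] [0, 2, 5])
))))))

def FB3 : List (ℕ × ℕ) := FB2 ++ [(9, mat121)]

theorem chk121 : checkRoot FB2 9 mat121
    [133, 386, 34, 18, 50, 114, 266, 42, 404, 84, 400, 80, 48, 112, 96, 384]
    [2184644193, 31694275361, 31477207585, 35971743809, 35974877249, 36004970529, 34414596177, 23424173601, 1896363617, 35989242657, 35975860289, 4365776465, 4386731601, 1916274273, 2164733537, 34430325329, 34427315537, 23424667649, 23408939009, 9302933783378, 9278759059555]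
    tree121 = true := by
  decide +kernel

def mat123 : ℕ := 32667605716045649976352060346850905227378

def tree123 : Tree :=
  (.ext [7] [5, 6, 8])

def FB4 : List (ℕ × ℕ) := FB3 ++ [(9, mat123)]

theorem chk123 : checkRoot FB3 9 mat123
    [2, 386, 34, 18, 402, 82, 50, 114, 394, 42, 404, 84, 16, 400, 80, 96, 384]
    [31477207585, 31694275361, 1932002657, 2200372577, 35756445729, 35989242657, 17199297873, 4365776465, 1896363617, 31461478433, 1946690913, 2215060833, 2164733537, 9304258330674, 9300282052658, 504140873860, 508218708100, 9298674585682, 9298658726482, 9278541926499, 9302933783378, 9278759059555]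
    tree123 = true := by
  decide +kernel

def mat124 : ℕ := 65335709851311066868905043958553513361522

def tree124 : Tree :=
  (.split 290 6467455667855595543224490471553678593055064178 [265, 645, 290, 274, 306, 298, 132, 644, 196, 708, 212, 724, 264, 296, 720, 704, 640]
   [1932068193, 6767540257, 36828086561, 30217224273, 2468808033]
   [265, 133, 18, 274, 146, 210, 306, 298, 132, 196, 212, 264, 296, 208, 288, 192, 128, 256]
  (.col 645 298 80 [
    (265, 2, [2719367265]),
    (645, 1, [2739212385]),
    (290, 0, [2737243489]),
    (274, 0, [27951909409]),
    (306, 0, [2737243489]),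
    (298, 0, [2751931745]),
    (132, 1, [2754941537]),
    (644, 1, [2754941537]),
    (196, 1, [2754941537]),
    (708, 1, [2754941537]),
    (212, 1, [2701669985]),
    (724, 1, [2701669985]),
    (264, 0, [2703639393]),
    (296, 0, [2703639393]),
    (720, 1, [2701669985]),
    (704, 1, [2701669985]),
    (640, 1, [2793740641])])
 (.split 210 4683221830059778727178418236181542224156491890 [265, 777, 133, 146, 210, 298, 132, 196, 212, 264, 776, 296, 808, 208]
   [2184775265, 19634620193, 23408417057, 32533119265, 521891022466]
   [265, 133, 18, 274, 146, 306, 298, 132, 196, 212, 264, 296, 208, 288, 192, 128, 256]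
  (.col 773 42 208 [
    (265, 2, [2719367265]),
    (777, 2, [2719367265]),
    (133, 1, [2739212385]),
    (146, 0, [23408417313]),
    (210, 0, [23408417313]),
    (298, 2, [2751931745]),
    (132, 1, [2754941537]),
    (196, 1, [2754941537]),
    (212, 1, [2701669985]),
    (264, 2, [2703639393]),
    (776, 2, [2703639393]),
    (296, 2, [2703639393]),
    (808, 2, [2703639393]),
    (208, 0, [2701669985])])
 (.split 306 6824267591032085513489071408649018116441178226 [265, 133, 645, 274, 306, 298, 132, 644, 196, 708, 212, 264, 296]
   [1932068193, 6767540257, 27951909153, 36828086561, 590326531458]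
   [265, 133, 18, 274, 146, 298, 132, 196, 212, 264, 296, 208, 288, 192, 128, 256]
  (.col 645 298 80 [
    (265, 2, [2719367265]),
    (133, 1, [2739212385]),
    (645, 1, [2739212385]),
    (274, 0, [27951909409]),
    (306, 0, [2737243489]),
    (298, 0, [2751931745]),
    (132, 1, [2754941537]),
    (644, 1, [2754941537]),
    (196, 1, [2754941537]),
    (708, 1, [2754941537]),
    (212, 1, [2701669985]),
    (264, 0, [2703639393]),
    (296, 0, [2703639393])])
 (.split 298 6645861629443840528356776217878980673178763378 [265, 645, 18, 274, 298, 132, 644, 196, 708, 212, 724, 264, 296, 208, 720]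
   [1946756449, 590055752580, 1980310881, 30217224273, 2218072417, 504713189762, 590055752581]
   [265, 133, 18, 274, 146, 132, 196, 212, 264, 296, 208, 288, 192, 128, 256]
  (.col 645 298 80 [
    (265, 2, [2719367265]),
    (645, 1, [2739212385]),
    (18, 0, [2785616225]),
    (274, 0, [27951909409]),
    (298, 0, [2751931745]),
    (132, 1, [2754941537]),
    (644, 1, [2754941537]),
    (196, 1, [2754941537]),
    (708, 1, [2754941537]),
    (212, 1, [2701669985]),
    (724, 1, [2701669985]),
    (264, 0, [2703639393]),
    (296, 0, [2703639393]),
    (208, 1, [2701669985]),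
    (720, 1, [2701669985])])
 (.split 212 4727823320456839973461489672726841146158153842 [777, 133, 18, 146, 132, 196, 212, 264, 776, 296, 808, 208]
   [2164864609, 521087750788, 1898334561, 2231973473, 34515259473, 577439287682, 521087750789]
   [265, 133, 18, 274, 146, 132, 196, 264, 296, 208, 288, 192, 128, 256]
  (.col 261 554 208 [
    (777, 2, [2719367265]),
    (133, 1, [2739212385]),
    (18, 0, [2768843873]),
    (146, 0, [23408417313]),
    (132, 1, [2754941537]),
    (196, 1, [2754941537]),
    (212, 1, [2701669985]),
    (264, 2, [2703639393]),
    (776, 2, [2703639393]),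
    (296, 2, [2703639393]),
    (808, 2, [2703639393]),
    (208, 0, [2701669985])])
 (.split 208 4638620339662717480895346799636245501110976626 [777, 133, 146, 132, 196, 264, 776, 296, 808, 208, 800, 768]
   [2184775265, 19634620193, 32517391393, 34515259473, 2433234529]
   [265, 133, 18, 274, 146, 132, 196, 264, 296, 288, 192, 128, 256]
  (.col 773 42 208 [
    (777, 2, [2719367265]),
    (133, 1, [2739212385]),
    (146, 0, [23408417313]),
    (132, 1, [2754941537]),
    (196, 1, [2754941537]),
    (264, 2, [2703639393]),
    (776, 2, [2703639393]),
    (296, 2, [2703639393]),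
    (808, 2, [2703639393]),
    (208, 0, [2701669985]),
    (800, 2, [2737243489]),
    (768, 1, [2775992673])])
 (.split 288 6422854177458534296941419035008381870009548914 [265, 18, 658, 264, 288, 704, 640, 256]
   [40067142177, 1932068193, 2468808033, 10398170354258, 12902298961, 4352211025, 10378053554275]
   [265, 133, 18, 274, 146, 132, 196, 264, 296, 192, 128, 256]
  (.ext [7] [5, 8, 9])
 (.split 192 4281808416486227510630765862540905977724862578 [133, 18, 786, 132, 192, 128, 768]
   [40284209953, 2184775265, 2453145185, 10471164887890, 8657667665, 17219290961, 10446990164067]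
   [265, 133, 18, 274, 146, 132, 196, 264, 296, 128, 256]
  (.ext [8] [6, 7, 9])
 (.split 18 401478749283402527614521278684594799944990834 [644, 196, 776, 296, 128, 640, 256, 768, 512]
   [636027555973, 26727174689, 39814456097, 38755837265, 38739129937, 36291805185, 32249544705]
   [265, 133, 274, 146, 132, 196, 264, 296, 128, 256]
  (.split 640 935384285333615763322965979698702624325020017819762 [644, 256, 1280, 1024]
    [32783747361, 27956127521, 44895839521, 41344337697, 42968957777]
    [644, 196, 776, 296, 128, 256, 768, 512]
   (.ext [0, 1, 3, 4, 5, 6] [2, 7, 8, 9])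
  (.split 644 941230291882939374995780719029567756408041794502770 [644, 776, 296, 256]
    [41344337697, 32803658017, 2754941537, 41344839681]
    [196, 776, 296, 128, 256, 768, 512]
   (.split 644 61683886795815835665523003783663452214024967352268161138 [644]
     [807117409, 3023376993, 2153490273, 41613275137]
     [776, 296, 256]
    (.ext [8] [6, 7])
   (.split 776 74326975007960115634632996873347348987421580845547585650 []
     [44835059745, 2972074849]
     [296, 256]
    (.ext [7, 8] [2, 3, 5, 6, 10, 11])
   (.ext [9, 10] [0, 1, 2, 4, 5, 7])
))  (.split 196 286454722395611572363562619811768453375790896447602 [196, 776, 1320, 128, 512]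
    [2754941537, 2164930145, 44565794881, 38661466705]
    [776, 296, 128, 256, 768, 512]
   (.split 776 74326320232390628306830364655248131188118548594649530482 []
     [49397409569, 2972074849, 41613796129, 1243656993, 37347150113, 41614254081]
     [196, 1320, 128, 512]
    (.ext [7, 8] [2, 3, 5, 6, 10, 11])
   (.ext [8] [6, 7, 10])
)  (.split 128 187072611057110173844582412772454526339000431870066 [776, 256, 1280, 768, 1792, 512, 1536, 1024]
    [42968957777, 44895839521, 27956127521]
    [776, 296, 256, 768, 512]
   (.ext [0, 1, 2, 4, 5, 6, 7] [3, 8, 9, 10])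
  (.ext [7] [5, 8])
)))) (.split 274 6110643744679105572340958404281580410800242802 [645, 644, 708, 296, 128]
   [6802139169, 26727174689, 27951909153, 636027555973, 40886089249]
   [265, 133, 146, 132, 196, 264, 296, 128, 256]
  (.split 645 942697502685265673617029130299409636413308582298738 [645, 644, 708, 296, 1320]
    [1932069473, 2739212385]
    [644, 708, 296, 128]
   (.ext [1] [0, 2, 9, 10])
  (.split 644 941236001047934770698825445466693353393652649754738 [644, 708, 296, 1320, 128]
    [2754941537]
    [708, 296, 128]
   (.col 645 1322 80 [
     (644, 1, [3023376993]),
     (708, 1, [3023376993]),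
     (296, 0, [2972074849]),
     (1320, 0, [2972074849]),
     (128, 1, [2958722913])])
  (.split 708 1034772105837112557544990913175142148347421337649266 [708, 1320]
    [44565794881, 1885940321, 2754941537]
    [296, 128]
   (.ext [8] [6, 7, 9, 10])
  (.ext [0, 1, 2, 4, 6, 9] [3, 5, 8])
))) (.split 146 3255974137353778281300924963391199193271173234 [777, 196, 776, 808, 256]
   [6819960609, 39814456097, 23408417057, 40634426657, 27956123425]
   [265, 133, 132, 196, 264, 296, 128, 256]
  (.split 777 1135612864491781360307682335107522375634541781255282 [777, 196, 1220, 776, 808]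
    [2184776289, 2719367265]
    [196, 776, 808, 256]
   (.ext [4] [0, 3, 9, 10])
  (.split 196 286457576890999642739316306215453159980184222630002 [196, 776, 1800, 1832]
    [2754941537, 44565794881, 2164930145]
    [776, 808, 256]
   (.col 773 1066 208 [
     (196, 1, [3023376993]),
     (776, 2, [2972074849]),
     (1800, 2, [2972074849]),
     (1832, 2, [2972074849])])
  (.ext [0, 1, 2, 3, 4, 5, 6, 7, 9] [8])
)) (.ext [1] [0, 2])
)))))))))))

def FB5 : List (ℕ × ℕ) := FB4 ++ [(9, mat124)]

theorem chk124 : checkRoot FB4 9 mat124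
    [265, 133, 290, 18, 274, 146, 210, 306, 298, 132, 196, 212, 264, 296, 208, 288, 192, 128, 256]
    [36291216673, 31510762017, 36056351521, 32229045793, 31408406593, 35974877249, 31461478433, 36305904929, 32248956449, 36004970529, 35971743809, 31411540033, 7719149068404, 8822201667700]
    tree124 = true := by
  decide +kernel

def mat003 : ℕ := 32667605715411819840534649173049906364530

def tree003 : Tree :=
  (.split 34 758258004355756599251024975561907478592815218 [897, 66, 98, 82, 114, 10, 4, 772, 644, 388, 900, 20, 276, 788, 148, 660, 404, 8, 776, 648, 392, 80, 96, 640, 384, 896, 768]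
   [13522473249, 1946781025, 2215212385, 2483582305, 17206637905, 14110711841, 30132478289, 6781693953, 6765965313, 9300282511410, 3453523415094]
   [385, 66, 98, 18, 274, 146, 402, 82, 50, 114, 10, 266, 138, 394, 4, 260, 132, 388, 20, 276, 148, 404, 8, 264, 136, 392, 80, 48, 112, 96, 128, 384, 256]
  (.split 660 964614674859488894041111312875614627966693943869554 [897, 66, 98, 1122, 114, 1034, 660, 8, 896]
    [34361455185, 20003690785, 32750187041, 44845532705, 1883843169, 2420583009, 23372778017, 44024877121, 41439736865, 6765443617, 25863400017, 8083180946454]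
    [897, 66, 98, 82, 114, 10, 4, 772, 644, 388, 900, 20, 276, 788, 148, 404, 8, 776, 648, 392, 80, 96, 640, 384, 896, 768]
   (.ext [8] [5, 6, 7])
  (.split 66 96459866321843948439172088398856922900559212904562 [1921, 98, 114, 1796, 1668, 1412, 900, 1924, 20, 276, 1300, 788, 148, 1172, 404, 8, 1800, 1672, 392, 96, 1664, 384, 1920, 1792]
    [2483691873, 2752061793, 13505700129, 604672353, 14127484961, 28547490081, 17207686737, 1946846817, 2215278177, 2752018017, 7034400769, 28547751937, 9304309108786]
    [897, 98, 82, 114, 10, 4, 772, 644, 388, 900, 20, 276, 788, 148, 404, 8, 776, 648, 392, 80, 96, 640, 384, 896, 768]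
   (.split 1668 159765749796160415194207138059190012202415019039285117042 [1921, 2146, 114, 1668, 148, 8, 1800, 392, 2144, 1664, 1920, 1792]
     [34361520721, 49190831393, 28547492641, 33018622497, 1932172129, 13025089873, 17321106001, 35757166593]
     [1921, 98, 114, 1796, 1412, 900, 1924, 20, 276, 1300, 788, 148, 1172, 404, 8, 1800, 1672, 392, 96, 1664, 384, 1920, 1792]
    (.ext [5, 9] [0, 1, 6, 7, 8, 10, 11])
   (.split 20 1915715885948682916896372956026323115378196215197139058 [1921, 98, 114, 20, 8, 2056, 1800, 1672, 392, 2440, 96, 1664, 3712, 384, 2432, 1920, 1792, 3840, 2048]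
     [34361520721, 30066553425, 20159426561, 28548214785, 47261971793, 9304319987747]
     [1921, 98, 114, 1796, 1412, 900, 1924, 276, 1300, 788, 148, 1172, 404, 8, 1800, 1672, 392, 96, 1664, 384, 1920, 1792]
    (.ext [5, 9] [0, 1, 6, 7, 8, 10])
   (.split 276 26435644539803601548917379472404443044474042431431835762 [1921, 98, 2146, 114, 1796, 8, 1800, 1672, 2144, 1664, 1920, 1792]
     [30066553425, 23641213729, 44716570657, 49408931105, 38756103249, 43034293329]
     [1921, 98, 114, 1796, 1412, 900, 1924, 1300, 788, 148, 1172, 404, 8, 1800, 1672, 392, 96, 1664, 384, 1920, 1792]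
    (.ext [5, 9] [0, 1, 6, 7, 8, 10])
   (.split 148 14175680212875793794396973139508123567558565674908713074 [1921, 98, 2146, 114, 8, 1800, 1672, 2144, 1664, 1920, 1792]
     [34361520721, 23372778273, 44716570401, 49140499745, 43034293329]
     [1921, 98, 114, 1796, 1412, 900, 1924, 1300, 788, 1172, 404, 8, 1800, 1672, 392, 96, 1664, 384, 1920, 1792]
    (.ext [5, 9] [0, 1, 6, 7, 8, 10])
   (.split 1172 112258387983645934418507664023665314266782124844507267186 [1921, 98, 2146, 114, 8, 1920]
     [34361520721, 11698988833, 2689018721, 20273175073, 23372778273, 49140499745, 36122442273, 7033879329]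
     [1921, 98, 114, 1796, 1412, 900, 1924, 1300, 788, 404, 8, 1800, 1672, 392, 96, 1664, 384, 1920, 1792]
    (.ext [8] [5, 6, 7])
   (.split 1672 160148873681376887408796724815977589498896155776041418866 [1921, 2146, 114, 1796, 1412, 900, 1924, 1920, 1792]
     [33021764385, 49190831393, 35736566049, 6781172513, 41611698977, 1916443489, 49128415233, 49665286145, 49933721601, 35737255937]
     [1921, 98, 114, 1796, 1412, 900, 1924, 1300, 788, 404, 8, 1800, 392, 96, 1664, 384, 1920, 1792]
    (.col 1925 106 2064 [
      (1921, 1, [3256172641]),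
      (2146, 0, [3288888673]),
      (114, 0, [31441570849]),
      (1796, 1, [27969756193]),
      (1412, 1, [23406357537]),
      (900, 1, [27701320737]),
      (1924, 1, [27701320737]),
      (1920, 1, [3283507041]),
      (1792, 1, [3256572257])])
   (.split 1664 159382625910943942979617551302402434906510325462646194290 [1921, 2146, 1796, 1412, 900, 1924, 8, 2056, 1800, 392, 2144, 384, 1920, 1792, 2048]
     [49712988449, 49140499745, 49128415233, 35736566049, 49665286145, 49933721601, 35737255937]
     [1921, 98, 114, 1796, 1412, 900, 1924, 1300, 788, 404, 8, 1800, 392, 96, 384, 1920, 1792]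
    (.ext [4] [0, 3])
   (.ext [7] [5, 6, 8])
)))))))  (.split 82 119843892519138395130431045741206917146532714446962 [1921, 98, 114, 4, 772, 644, 388, 900, 20, 8, 776, 648, 392, 96, 384, 1920]
    [31710005793, 2469003617, 36024883745, 9139742942310, 9479169057, 14110714401, 19957555489, 31729916449, 36004973089, 8040231314534, 346050306434, 9278810364514, 9278759062114]
    [897, 98, 114, 10, 4, 772, 644, 388, 900, 20, 276, 788, 148, 404, 8, 776, 648, 392, 80, 96, 640, 384, 896, 768]
   (.split 4 383243729108991352984717187833318502821840109353369714 [1921, 114, 20, 8, 2056, 392, 2440, 96, 384, 2432, 1920, 2048]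
     [30066553425, 2603221345, 47312303441, 47299566161, 47848657185, 18137264673, 34361520721, 31462199297, 6781890561, 6781894657]
     [1921, 98, 114, 772, 644, 388, 900, 20, 8, 776, 648, 392, 96, 384, 1920]
    (.ext [7] [5, 6, 8])
   (.split 772 73943029736344279619063544766886483330101182599711228018 [1921, 2146, 114, 8, 2056, 2144, 1920]
     [30066553425, 11716810785, 49459262753, 37313589793, 49400120897, 31575816481, 27969755937, 31462199297]
     [1921, 98, 114, 644, 388, 900, 20, 8, 776, 648, 392, 96, 384, 1920]
    (.ext [7] [5, 6, 8])
   (.split 644 61683065409416471864543138433990163853185705843188105330 [1921, 2146, 114, 8, 2056, 2144, 1920]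
     [11716810529, 49190831393, 34361520721, 33018622497, 2340030049, 35870783777, 27701320481, 35757166593]
     [1921, 98, 114, 388, 900, 20, 8, 776, 648, 392, 96, 384, 1920]
    (.ext [8] [5, 6, 7])
   (.split 388 37163136709891020862506323887693238884098055785299640434 [1921, 2146, 114, 900, 8, 2056, 2144, 1920, 2048]
     [11716810529, 49190835489, 33018622497, 18137264673, 11716810785, 14111432705]
     [1921, 98, 114, 900, 20, 8, 776, 648, 392, 96, 384, 1920]
    (.ext [7] [5, 6, 8, 11])
   (.split 900 86202994063271390496564144950368283782281552059422802034 [1921, 98, 2146, 114, 900, 8, 96, 2144, 1920]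
     [11716810529, 33018622497, 11716810785, 27701320481, 12911672145, 9325786566658]
     [1921, 98, 114, 20, 8, 776, 648, 392, 96, 384, 1920]
    (.ext [7] [5, 6, 8, 11])
   (.split 20 1915739269974880211343064214983665465372442188698681458 [1921, 98, 114, 20, 2056, 2440, 96, 384]
     [889955425, 3037344865, 20159426561, 2768974945, 47261971793, 6819622913, 6820671489, 9304319987747]
     [1921, 98, 114, 8, 776, 648, 392, 96, 384, 1920]
    (.ext [3] [2, 4, 11])
   (.ext [2] [1, 3])
))))))  (.split 80 116920889244476589294023676075774351107220782252146 [114, 10, 4, 1796, 1668, 388, 900, 20, 8, 1800, 1672, 392, 1416, 96, 1664, 384, 1408, 896, 1792]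
    [2164946529, 1896515169, 2701686369, 19890991105, 44058038305, 9479169057, 4373116497, 30082217041, 19883651073, 9304258789426]
    [897, 98, 114, 10, 4, 772, 644, 388, 900, 20, 276, 788, 148, 404, 8, 776, 648, 392, 96, 640, 384, 896, 768]
   (.split 1668 159765770257183337826847992910777689119843225700854464626 [114, 10, 8, 1800, 1416, 896, 1792]
     [45903524385, 19883129633, 19872164673, 11683252769, 33018622497, 49140499745, 36024924705, 41662048801, 19955460897, 35757166593]
     [114, 10, 4, 1796, 388, 900, 20, 8, 1800, 1672, 392, 1416, 96, 1664, 384, 1408, 896, 1792]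
    (.split 8 50376579653350629448513163378572109017939839702917737414770 [896, 1792, 4096]
      [1260438305, 50133468193, 51732022609, 51585111889, 51585108561]
      [114, 10, 1800, 1416, 896, 1792]
     (.ext [0, 1, 2, 3, 4] [5, 6, 9, 10, 11, 12])
    (.col 1925 2154 16 [
      (114, 0, [31441570849]),
      (10, 0, [3288932705]),
      (1800, 2, [6781176865]),
      (1416, 2, [23390628897]),
      (896, 1, [3266729825]),
      (1792, 1, [19890474017])])
)   (.split 1672 160148894142399810041437579667565266416324362437610766450 [114, 4, 1796, 900, 20, 1408, 1792]
     [41611698977, 6781172513, 6718896961, 35736566049, 33021764385, 49140499745, 45937088801, 6818904865, 35737255937]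
     [114, 10, 4, 1796, 388, 900, 20, 8, 1800, 392, 1416, 96, 1664, 384, 1408, 896, 1792]
    (.split 4 25268555835689122865384595272498230930825746157885934862450 [1408, 1792, 4096]
      [48051044897, 49863983393, 51732022609, 51601889105, 51601807697]
      [114, 1796, 900, 20, 1408, 1792]
     (.ext [0, 1, 2, 3, 4] [5, 6, 9, 10, 11, 12])
    (.col 1925 106 2064 [
      (114, 0, [31441570849]),
      (1796, 1, [27969756193]),
      (900, 1, [27701320737]),
      (20, 1, [3238671457, 51601889105, 51601807697]),
      (1408, 1, [3283507041]),
      (1792, 1, [19890474017])])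
)   (.split 1664 159382646371966865612258406153990111823938532124215541874 [2058, 4, 1796, 388, 900, 2068, 8, 1800, 392, 1416, 384, 1792]
     [19890469665, 49712988449, 49727676705, 49945785377, 49140499745, 35736566049, 45937088801, 41662048801, 35737255937]
     [114, 10, 4, 1796, 388, 900, 20, 8, 1800, 392, 1416, 96, 384, 1408, 896, 1792]
    (.split 1796 11273834105387252670468198171789967624885576725047073172684914 [8]
      [46171959841, 33018661153, 19956509729, 19873213505, 11815402017, 11823106625]
      [2058, 4, 388, 900, 2068, 8, 1800, 392, 1416, 384, 1792]
     (.ext [7, 11] [5, 6, 8, 9, 10, 12])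
    (.split 1800 11298942512328799393523541329482798290549987299728841731539058 [4]
      [41880134433, 6819953697, 6719945793, 31441602849, 16107223329, 16117995841]
      [2058, 4, 388, 900, 2068, 8, 392, 1416, 384, 1792]
     (.ext [7, 11] [5, 6, 8, 9, 10, 12])
    (.split 1792 11248725698445705947412855014097136959221167303251624848588914 [4, 388, 8, 392, 384]
      [19890474017, 54022644001, 54240752673, 31441602849, 8596011345, 12892027473, 33019408385, 33022550017]
      [2058, 4, 388, 900, 2068, 8, 392, 1416, 384]
     (.ext [7, 11] [5, 6, 8, 9, 10, 12])
    (.ext [8] [5, 6, 7])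
)))   (.ext [7] [5, 6, 8])
)))  (.ext [6] [0, 5, 7, 8])
)))) (.split 50 1115069927532246569515605912657247001978929266 [385, 897, 66, 98, 82, 114, 10, 4, 260, 132, 388, 20, 8, 264, 136, 392, 80, 112, 96, 128, 384, 896, 256]
   [9495942177, 31441570081, 35756448033, 8108935254374, 8108950787174, 31461480737, 35736537377, 9208446882150, 9208462414950, 9278541928802, 9278490626402]
   [385, 66, 98, 18, 274, 146, 402, 82, 114, 10, 266, 138, 394, 4, 260, 132, 388, 20, 276, 148, 404, 8, 264, 136, 392, 80, 48, 112, 96, 128, 384, 256]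
  (.split 385 562679245790779616394012302451668833052907777885298 [385, 897, 10, 4, 20, 8, 1120, 128, 384, 896, 256]
    [13589582113, 9563051041, 8746854225, 13041821521, 2719301729, 11407470137682, 11407485670482, 11407470137699, 1377452129, 8746854481, 13041821777, 2739212385, 9321491468322, 9321440100386]
    [897, 66, 98, 82, 114, 10, 4, 260, 132, 388, 20, 8, 264, 136, 392, 80, 112, 96, 128, 384, 896, 256]
   (.ext [6] [0, 5, 7, 8])
  (.split 896 1309529418429954302954192184545200648019271431290994 [897, 1090, 1122, 1106, 1138, 4, 260, 132, 388, 8, 264, 136, 392, 1104, 1136, 1120, 128, 384, 896, 256]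
    [45418021153, 45402293281, 2719304033, 45466263841, 45466268705, 1377454433, 2739214689, 9321491470626, 9321440102690]
    [897, 66, 98, 82, 114, 10, 4, 260, 132, 388, 20, 8, 264, 136, 392, 80, 112, 96, 128, 384, 256]
   (.ext [0, 6] [1, 4, 5, 7, 8, 9, 10])
  (.ext [9] [0, 1, 4, 5])
)) (.split 48 1070468437135185323232534476111950278933414002 [897, 66, 82, 114, 10, 266, 778, 138, 650, 394, 4, 772, 644, 388, 20, 8, 776, 648, 392, 904, 80, 112, 96, 640, 384, 896, 768]
   [9495942177, 1896449377, 2164880737, 2433250657, 39763075105, 4372067665, 30082151505, 19630944257, 19615215617, 9300232192050, 3453515489318]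
   [385, 66, 98, 18, 274, 146, 402, 82, 114, 10, 266, 138, 394, 4, 260, 132, 388, 20, 276, 148, 404, 8, 264, 136, 392, 80, 112, 96, 128, 384, 256]
  (.split 650 949999970696612644287798446039063170107434550493298 [897, 114, 650, 4, 1044, 80, 112, 1136, 896]
    [34364597073, 7118801185, 32816242977, 1880701537, 2417441377, 23424145953, 41439732001, 32753328929, 1242976353, 44895864097, 19630422561, 25863330385, 8083165413654]
    [897, 66, 82, 114, 10, 266, 778, 138, 394, 4, 772, 644, 388, 20, 8, 776, 648, 392, 904, 80, 112, 96, 640, 384, 896, 768]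
   (.ext [8] [5, 6, 7])
  (.split 66 96460178532276727867896069908357472943359553503346 [114, 10, 4, 1796, 1668, 388, 1412, 20, 8, 1800, 1672, 392, 904, 96, 1664, 384, 1408, 896, 1792]
    [2215278177, 1946846817, 2752018017, 7056420865, 13505700129, 17207686737, 14127484961, 30132543825, 7050129409, 9304309108786]
    [897, 82, 114, 10, 266, 778, 138, 394, 4, 772, 644, 388, 20, 8, 776, 648, 392, 904, 80, 112, 96, 640, 384, 896, 768]
   (.split 1668 159765749796472625626986566783171521702965061839625715826 [114, 10, 8, 1800, 904, 1408, 1792]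
     [41608557089, 19614694177, 19603794753, 11682203937, 33018622497, 49140499745, 35756488993, 45957011745, 19703802657, 35757166593]
     [114, 10, 4, 1796, 388, 1412, 20, 8, 1800, 1672, 392, 904, 96, 1664, 384, 1408, 896, 1792]
    (.split 8 50376579632889918736313301952444502850522961539056508665970 [1408, 1792, 4096]
      [1260438305, 49865032737, 51732022609, 51585111889, 51585042769]
      [114, 10, 1800, 904, 1408, 1792]
     (.ext [0, 1, 2, 3, 4] [5, 6, 9, 10, 11, 12])
    (.col 1925 2154 16 [
      (114, 0, [31441570849]),
      (10, 0, [3288998241]),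
      (1800, 2, [27954027553]),
      (904, 2, [27685592097]),
      (1408, 1, [3266729825]),
      (1792, 1, [7055903777])])
)   (.split 1672 160148873681689097841576153539959098999446198576382017650 [114, 4, 1796, 1412, 20, 896, 1792]
     [45906666273, 7049607969, 6987266881, 36005001761, 33021764385, 49140499745, 41642125857, 7070563105, 35737255937]
     [114, 10, 4, 1796, 388, 1412, 20, 8, 1800, 392, 904, 96, 1664, 384, 1408, 896, 1792]
    (.split 4 25268555815228412153184733846370624763408867994024706113650 [896, 1792, 4096]
      [48051044897, 50132418849, 51732022609, 51601889105, 51601873489]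
      [114, 1796, 1412, 20, 896, 1792]
     (.ext [0, 1, 2, 3, 4] [5, 6, 9, 10, 11, 12])
    (.col 1925 106 2064 [
      (114, 0, [31441570849]),
      (1796, 1, [19614698529]),
      (1412, 1, [23406357537]),
      (20, 1, [3238605921, 51601889105, 51601873489]),
      (896, 1, [3283507041]),
      (1792, 1, [7055903777])])
)   (.split 1664 159382625911256153412396980026383944407060368262986793074 [2058, 4, 1796, 388, 1412, 2068, 8, 1800, 392, 904, 384, 1792]
     [7055899425, 49981423905, 49996112161, 49677349921, 49140499745, 35756488993, 45957011745, 41642125857, 35737255937]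
     [114, 10, 4, 1796, 388, 1412, 20, 8, 1800, 392, 904, 96, 384, 1408, 896, 1792]
    (.split 1796 11273834105366791959755998310363840018718159846883211943936114 [8]
      [41876992545, 11815401761, 19704851489, 19604843585, 31461525793, 11823040833]
      [2058, 4, 388, 1412, 2068, 8, 1800, 392, 904, 384, 1792]
     (.ext [7, 11] [5, 6, 8, 9, 10, 12])
    (.split 1800 11298942512308338682811341468056670684382570421564980502790258 [4]
      [46175101729, 7071611937, 6988315713, 33021806881, 16107223585, 16118061633]
      [2058, 4, 388, 1412, 2068, 8, 392, 904, 384, 1792]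
     (.ext [7, 11] [5, 6, 8, 9, 10, 12])
    (.split 1792 11248725698425245236700655152671009353053750425087763619840114 [4, 388, 8, 392, 384]
      [7055903777, 54291079457, 53972317217, 31461525793, 12890978641, 8597060177, 33019408385, 33022550017]
      [2058, 4, 388, 1412, 2068, 8, 392, 904, 384]
     (.ext [7, 11] [5, 6, 8, 9, 10, 12])
    (.ext [8] [5, 6, 7])
)))   (.ext [7] [5, 6, 8])
)))  (.split 82 119844204729571174559155027250707467189333055045746 [1921, 114, 10, 4, 772, 644, 388, 8, 776, 648, 392, 904, 112, 96, 384, 1920]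
    [31710005793, 2453275745, 36024883745, 9139727409510, 9479169057, 39763077665, 7072658465, 31729916449, 36004973089, 8040215781734, 346065839234, 9278810364514, 9278759062114]
    [897, 114, 10, 266, 778, 138, 394, 4, 772, 644, 388, 20, 8, 776, 648, 392, 904, 80, 112, 96, 640, 384, 896, 768]
   (.split 772 73943029736656490051842973490867992830651225400051826802 [1921, 114, 2160, 1920]
     [11716810785, 19614698273, 37313589793, 49664361537, 49408931105, 41608557089, 49400120897, 31461521697, 19704851233, 31462199297]
     [1921, 114, 10, 4, 644, 388, 8, 776, 648, 392, 904, 112, 96, 384, 1920]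
    (.ext [3] [2, 4])
   (.split 776 74326153621872962266432560247655570127132362136808128626 [1921, 114, 4, 2052, 2160, 2144, 1920]
     [37316731681, 49408931105, 30069695313, 16011778081, 49400120897, 31578962209, 27954027297, 31442288641]
     [1921, 114, 10, 4, 644, 388, 8, 648, 392, 904, 112, 96, 384, 1920]
    (.ext [7] [5, 6, 8])
   (.ext [8] [5, 6, 7])
))  (.split 80 116921201454909368722747657585274901150021122850930 [1921, 114, 10, 266, 1290, 778, 138, 1162, 394, 4, 1796, 1668, 388, 1800, 1672, 1416, 904, 1928, 112, 96, 1664, 384, 1920, 1792]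
    [2433365089, 2701735009, 822776929, 44058038305, 9479169057, 28547494945, 1896515169, 2164946529, 2701686369, 19899379713, 28547682305, 9304258789426]
    [897, 114, 10, 266, 778, 138, 394, 4, 772, 644, 388, 20, 8, 776, 648, 392, 904, 112, 96, 640, 384, 896, 768]
   (.split 10 957926634242635445842689639626528515239322724925243506 [1921, 114, 10, 4, 2052, 1796, 1668, 388, 2436, 112, 96, 1664, 3712, 384, 2432, 1920, 1792, 3840, 2048]
     [34364662609, 30069695313, 7324856321, 28548210689, 47312303441, 9304269668387]
     [1921, 114, 266, 1290, 778, 138, 1162, 394, 4, 1796, 1668, 388, 1800, 1672, 1416, 904, 1928, 112, 96, 1664, 384, 1920, 1792]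
    (.ext [5, 9] [0, 4, 6, 7, 8, 10])
   (.split 266 25477855288097554077863696156004648444335168941159940210 [1921, 114, 4, 1796, 1668, 1800, 112, 2160, 2144, 1664, 1920, 1792]
     [30069695313, 23692581665, 44716570657, 49459262753, 38756098385, 43034288465]
     [1921, 114, 1290, 778, 138, 1162, 394, 4, 1796, 1668, 388, 1800, 1672, 1416, 904, 1928, 112, 96, 1664, 384, 1920, 1792]
    (.ext [5, 9] [0, 4, 6, 7, 8, 10])
   (.split 138 13217890961169746323343289823108328967419692184636817522 [1921, 114, 4, 1796, 1668, 1672, 112, 2160, 2144, 1664, 1920, 1792]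
     [34364662609, 23424146209, 44716570401, 49190831393, 43034288465]
     [1921, 114, 1290, 778, 1162, 394, 4, 1796, 1668, 388, 1800, 1672, 1416, 904, 1928, 112, 96, 1664, 384, 1920, 1792]
    (.ext [5, 9] [0, 4, 6, 7, 8, 10])
   (.split 1162 111300598731939886947453980707265519666643251354235371634 [1921, 114, 4, 112, 2160, 1920]
     [34364662609, 7388285473, 7404021537, 2685877089, 23424146209, 49190831393, 36125588001, 19898858273]
     [1921, 114, 1290, 778, 394, 4, 1796, 1668, 388, 1800, 1672, 1416, 904, 1928, 112, 96, 1664, 384, 1920, 1792]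
    (.ext [8] [5, 6, 7])
   (.split 1668 159765770257495548259627421634759198620393268501195063410 [1921, 114, 1800, 1416, 904, 1928, 2160, 1920, 1792]
     [33018622497, 49140499745, 11682203937, 19614694177, 41608557089, 1898617697, 49125273601, 35756488993, 49662144513, 49930579969, 35757166593]
     [1921, 114, 1290, 778, 394, 4, 1796, 388, 1800, 1672, 1416, 904, 1928, 112, 96, 1664, 384, 1920, 1792]
    (.col 1925 2154 16 [
      (1921, 1, [3256172641]),
      (114, 0, [31441570849]),
      (1800, 2, [27954027553]),
      (1416, 2, [23390628897]),
      (904, 2, [27685592097]),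
      (1928, 2, [27685592097]),
      (2160, 0, [3238557025]),
      (1920, 1, [3266729825]),
      (1792, 1, [3266660705])])
   (.split 1672 160148894142712020474217008391546775916874405237951365234 [1921, 114, 4, 1796, 388, 1672, 2160, 2144, 1664, 1920, 1792]
     [34364662609, 49140499745, 28547496737, 1916443489, 35737255937]
     [1921, 114, 1290, 778, 394, 4, 1796, 388, 1800, 1416, 904, 1928, 112, 96, 1664, 384, 1920, 1792]
    (.ext [5, 9] [0, 4, 6, 7, 8, 10, 11])
   (.split 1664 159382646372279076045037834877971621324488574924556140658 [1921, 4, 2052, 1796, 388, 1800, 1416, 904, 1928, 2160, 2144, 384, 1920, 1792, 2048]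
     [49697260577, 49140499745, 49125273601, 35756488993, 49662144513, 49930579969, 35737255937]
     [1921, 114, 1290, 778, 394, 4, 1796, 388, 1800, 1416, 904, 1928, 112, 96, 384, 1920, 1792]
    (.ext [1] [0, 2])
   (.ext [7] [5, 6, 8])
)))))))  (.ext [6] [0, 5, 7, 8])
)))) (.ext [5] [0, 6, 7, 8])
)))

def FB6 : List (ℕ × ℕ) := FB5 ++ [(9, mat003)]

theorem chk003 : checkRoot FB5 9 mat003
    [385, 66, 34, 98, 18, 274, 146, 402, 82, 50, 114, 10, 266, 138, 394, 4, 260, 132, 388, 20, 276, 148, 404, 8, 264, 136, 392, 80, 48, 112, 96, 128, 384, 256]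
    [31441567777, 13960106049, 1108758625, 35756445729, 1377189985, 8657597777, 1645559905, 31461478433, 35736535073, 12902233425, 1665470561, 9300285067298, 9300233699362, 9304311599138, 9304260231202, 9304311599139, 9304260231203, 9278541926498, 9278490624098]
    tree003 = true := by
  decide +kernel

/-! ### The nine-vertex configurations -/

def hit (FB : List (ℕ × ℕ)) (n : ℕ) (a : ℕ → ℕ → Bool) (p : ℕ) : Bool :=
  Nat.ble (nthF FB (dg p 0)).1 (dg p 1) && patOK FB n a p

theorem hit_sound {V : Type} {G : SimpleGraph V} {FB : List (ℕ × ℕ)} (hFB : FBOK G FB) {n : ℕ}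
    {a : ℕ → ℕ → Bool} {f : ℕ → V}
    (hinj : Inj n f) (ha : ∀ i < n, ∀ j < n, a i j = true ↔ G.Adj (f i) (f j))
    {p : ℕ} (h1 : hit FB n a p = true) : False := by
  have hno := nthF_ok hFB (dg p 0)
  unfold hit patOK at h1
  revert h1 hno
  generalize nthF FB (dg p 0) = q
  generalize dg p 1 = r
  obtain ⟨k, F⟩ := q
  simp only [Bool.and_eq_true, Nat.ble_eq]
  rintro ⟨hkr, h1⟩ hno
  rw [allLt_iff] at h1
  apply hno
  refine ⟨fun i => f (dg p (i + 2)), ?_⟩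
  intro i hi j hj
  dsimp only
  have hi1 := h1 i hi
  have hj1 := h1 j (by omega)
  simp only [Bool.or_eq_true, Bool.and_eq_true, beq_iff, blt_iff, xnor_iff, allLt_iff,
    Bool.not_eq_true'] at hi1 hj1
  have hi2 := hi1.resolve_left (by omega)
  have hj2 := hj1.resolve_left (by omega)
  have h3 := (hi2.2 j hj).resolve_left (by omega)
  constructor
  · intro h
    have h4 := hinj _ hi2.1 _ hj2.1 h
    have h5 := h3.1
    rw [← Bool.not_eq_true, beq_iff] at h5
    exact h5 h4
  · rw [← h3.2, ha _ hi2.1 _ hj2.1]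

def cfgRows (b0 b1 b2 b3 b4 b5 b6 : Bool) : ℕ → List Bool
  | 0 => [false, true, false, false, true, true, true, false, false]
  | 1 => [true, false, true, false, false, false, false, false, false]
  | 2 => [false, true, false, true, false, b0, b2, false, false]
  | 3 => [false, false, true, false, true, b1, b3, false, false]
  | 4 => [true, false, false, true, false, false, false, false, false]
  | 5 => [true, false, b0, b1, false, false, false, true, b5]
  | 6 => [true, false, b2, b3, false, false, false, b4, true]
  | 7 => [false, false, false, false, false, true, b4, false, b6]
  | _ => [false, false, false, false, false, b5, true, b6, false]

def nthB : List Bool → ℕ → Bool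
  | [], _ => false
  | x :: _, 0 => x
  | _ :: L, i + 1 => nthB L i

def cfg (b0 b1 b2 b3 b4 b5 b6 : Bool) (i j : ℕ) : Bool := nthB (cfgRows b0 b1 b2 b3 b4 b5 b6 i) j

def anyHit (FB : List (ℕ × ℕ)) (a : ℕ → ℕ → Bool) : List ℕ → Bool
  | [] => false
  | p :: L => hit FB 9 a p || anyHit FB a L

theorem anyHit_sound {V : Type} {G : SimpleGraph V} {FB : List (ℕ × ℕ)} (hFB : FBOK G FB)
    {a : ℕ → ℕ → Bool} {f : ℕ → V}
    (hinj : Inj 9 f) (ha : ∀ i < 9, ∀ j < 9, a i j = true ↔ G.Adj (f i) (f j))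
    {L : List ℕ} (h : anyHit FB a L = true) : False := by
  induction L with
  | nil => simp [anyHit] at h
  | cons p L ih =>
    simp only [anyHit, Bool.or_eq_true] at h
    exact h.elim (hit_sound hFB hinj ha) ih

def cfgPats : List ℕ := [554480, 406256, 340720, 36025209073, 36005298417, 31461871857, 31441961201, 554736, 36093300977, 9304260428018, 9304311730418, 9300233896178, 9300285198578, 9304260428019, 9304311730419, 8269493047540, 9304260428020, 8269441745140, 9304311730420, 9300285198581, 9304311730421, 8269493047542, 9304311730422, 9304311730423]

theorem cfg_hit : ∀ b0 b1 b2 b3 b4 b5 b6 : Bool,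
    anyHit FB6 (cfg b0 b1 b2 b3 b4 b5 b6) cfgPats = true := by
  decide +kernel

section
variable {V : Type} {G : SimpleGraph V}

theorem fbok_snoc {FB : List (ℕ × ℕ)} (h : FBOK G FB) {n A : ℕ} (hA : NoEmb G n A) :
    FBOK G (FB ++ [(n, A)]) := by
  refine ⟨h.1, fun q hq => ?_⟩
  rcases List.mem_append.1 hq with hq | hq
  · exact h.2 q hq
  · rw [List.mem_singleton.1 hq]; exact hA

theorem noK3 (hT : TriFree G) : NoEmb G 3 K3 := by
  rintro ⟨f, hf⟩
  have h1 := (hf 1 (by norm_num) 0 (by norm_num)).2.1 (by decide)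
  have h2 := (hf 2 (by norm_num) 0 (by norm_num)).2.1 (by decide)
  have h3 := (hf 2 (by norm_num) 1 (by norm_num)).2.1 (by decide)
  exact hT _ _ _ h3 h1 h2

theorem noFork (hF : ForkFree G) : NoEmb G 7 2535379780782312491558337839150 := by
  rintro ⟨f, hf⟩
  have hlt : ∀ i j : Fin 7, j < i → (fork.Adj i j ↔ tb (row 2535379780782312491558337839150 i) j = true) := by
    unfold fork
    simp only [SimpleGraph.fromEdgeSet_adj]
    decide
  have hne : ∀ i j : Fin 7, i ≠ j → f i ≠ f j := by
    intro i j hij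
    rcases lt_or_gt_of_ne hij with h | h
    · exact (hf j j.isLt i h).1.symm
    · exact (hf i i.isLt j h).1
  refine hF.false ⟨⟨fun i : Fin 7 => f i, ?_⟩, ?_⟩
  · intro i j h
    by_contra hij
    exact hne i j hij h
  · intro i j
    change G.Adj (f i) (f j) ↔ fork.Adj i j
    rcases lt_trichotomy i j with h | h | h
    · rw [G.adj_comm, fork.adj_comm, hlt j i h, (hf j j.isLt i h).2]
    · subst h; simp
    · rw [hlt i j h, (hf i i.isLt j h).2]

theorem fbok_all [Fintype V] (hG : MinCex G) : FBOK G FB6 := by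
  have hC := minCol hG
  have h0 : FBOK G FB0 := by
    refine ⟨noK3 hC.1, ?_⟩
    intro q hq
    rcases List.mem_cons.1 hq with rfl | hq
    · exact noK3 hC.1
    · rw [List.mem_singleton.1 hq]
      exact noFork hG.2.1
  have h1 : FBOK G FB1 := fbok_snoc h0 (root_sound hC h0 chk013)
  have h2 : FBOK G FB2 := fbok_snoc h1 (root_sound hC h1 chk113)
  have h3 : FBOK G FB3 := fbok_snoc h2 (root_sound hC h2 chk121)
  have h4 : FBOK G FB4 := fbok_snoc h3 (root_sound hC h3 chk123)
  have h5 : FBOK G FB5 := fbok_snoc h4 (root_sound hC h4 chk124)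
  exact fbok_snoc h5 (root_sound hC h5 chk003)

def nine (x0 x1 x2 x3 x4 x5 x6 x7 x8 : V) : ℕ → V
  | 0 => x0
  | 1 => x1
  | 2 => x2
  | 3 => x3
  | 4 => x4
  | 5 => x5
  | 6 => x6
  | 7 => x7
  | _ => x8

theorem exB (p : Prop) : ∃ b : Bool, p ↔ b = true := by
  classical
  exact ⟨decide p, by simp⟩

theorem nine_false (hT : TriFree G) (hFB : FBOK G FB6) (x0 x1 x2 x3 x4 a b u w : V)
    (h01 : G.Adj x0 x1) (h12 : G.Adj x1 x2) (h23 : G.Adj x2 x3) (h34 : G.Adj x3 x4)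
    (h40 : G.Adj x4 x0)
    (ha : G.Adj x0 a) (hb : G.Adj x0 b) (hu : G.Adj a u) (hw : G.Adj b w)
    (hab : a ≠ b) (haw : a ≠ w) (hbu : b ≠ u) (huw : u ≠ w)
    (hu' : ∀ x ∈ [x0, x1, x2, x3, x4], u ≠ x ∧ ¬ G.Adj u x)
    (hw' : ∀ x ∈ [x0, x1, x2, x3, x4], w ≠ x ∧ ¬ G.Adj w x)
    (d02 : x0 ≠ x2) (d03 : x0 ≠ x3) (d13 : x1 ≠ x3) (d14 : x1 ≠ x4) (d24 : x2 ≠ x4) : False := by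
  simp only [List.mem_cons, List.not_mem_nil, or_false, forall_eq_or_imp, forall_eq] at hu' hw'
  obtain ⟨⟨eu0, nu0⟩, ⟨eu1, nu1⟩, ⟨eu2, nu2⟩, ⟨eu3, nu3⟩, ⟨eu4, nu4⟩⟩ := hu'
  obtain ⟨⟨ew0, nw0⟩, ⟨ew1, nw1⟩, ⟨ew2, nw2⟩, ⟨ew3, nw3⟩, ⟨ew4, nw4⟩⟩ := hw'
  have na : ∀ x, ¬ G.Adj u x → a ≠ x := fun x h he => h (he ▸ hu.symm)
  have nb : ∀ x, ¬ G.Adj w x → b ≠ x := fun x h he => h (he ▸ hw.symm)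
  have n02 : ¬ G.Adj x0 x2 := fun h => hT _ _ _ h01 h12 h
  have n13 : ¬ G.Adj x1 x3 := fun h => hT _ _ _ h12 h23 h
  have n24 : ¬ G.Adj x2 x4 := fun h => hT _ _ _ h23 h34 h
  have n03 : ¬ G.Adj x0 x3 := fun h => hT _ _ _ h h34 h40.symm
  have n14 : ¬ G.Adj x1 x4 := fun h => hT _ _ _ h01 h h40.symm
  have a1 : ¬ G.Adj a x1 := fun h => hT _ _ _ ha h h01
  have a4 : ¬ G.Adj a x4 := fun h => hT _ _ _ ha h h40.symm
  have b1 : ¬ G.Adj b x1 := fun h => hT _ _ _ hb h h01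
  have b4 : ¬ G.Adj b x4 := fun h => hT _ _ _ hb h h40.symm
  have nab : ¬ G.Adj a b := fun h => hT _ _ _ ha h hb
  have ea0 := na _ nu0
  have ea1 := na _ nu1
  have ea2 := na _ nu2
  have ea3 := na _ nu3
  have ea4 := na _ nu4
  have eb0 := nb _ nw0
  have eb1 := nb _ nw1
  have eb2 := nb _ nw2
  have eb3 := nb _ nw3
  have eb4 := nb _ nw4
  clear na nb
  obtain ⟨p0, q0⟩ := exB (G.Adj a x2)
  obtain ⟨p1, q1⟩ := exB (G.Adj a x3)
  obtain ⟨p2, q2⟩ := exB (G.Adj b x2)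
  obtain ⟨p3, q3⟩ := exB (G.Adj b x3)
  obtain ⟨p4, q4⟩ := exB (G.Adj u b)
  obtain ⟨p5, q5⟩ := exB (G.Adj w a)
  obtain ⟨p6, q6⟩ := exB (G.Adj w u)
  have e01 := h01.ne
  have e12 := h12.ne
  have e23 := h23.ne
  have e34 := h34.ne
  have e40 := h40.ne
  have eau := hu.ne
  have ebw := hw.ne
  have lowInj : ∀ i < 9, ∀ j < i, nine x0 x1 x2 x3 x4 a b u w i ≠ nine x0 x1 x2 x3 x4 a b u w j := by
    intro i hi j hj
    interval_cases i <;> interval_cases j <;> simp only [nine] <;>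
      first | assumption | exact Ne.symm (by assumption)
  have lowAdj : ∀ i < 9, ∀ j < i, (cfg p0 p1 p2 p3 p4 p5 p6 i j = true ↔
      G.Adj (nine x0 x1 x2 x3 x4 a b u w i) (nine x0 x1 x2 x3 x4 a b u w j)) ∧
      cfg p0 p1 p2 p3 p4 p5 p6 i j = cfg p0 p1 p2 p3 p4 p5 p6 j i := by
    intro i hi j hj
    interval_cases i <;> interval_cases j <;>
      refine ⟨?_, rfl⟩ <;> simp only [nine, cfg, cfgRows, nthB, Bool.false_eq_true, false_iff, true_iff] <;>
      first
        | assumption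
        | exact SimpleGraph.Adj.symm (by assumption)
        | exact Iff.symm (by assumption)
        | exact fun h => absurd h.symm (by assumption)
  have diag : ∀ i < 9, cfg p0 p1 p2 p3 p4 p5 p6 i i = false := by
    intro i hi
    interval_cases i <;> rfl
  refine anyHit_sound (f := nine x0 x1 x2 x3 x4 a b u w) hFB ?_ ?_ (cfg_hit p0 p1 p2 p3 p4 p5 p6)
  · intro i hi j hj he
    rcases lt_trichotomy i j with h | h | h
    · exact absurd he.symm (lowInj j hj i h)
    · exact h
    · exact absurd he (lowInj i hi j h)
  · intro i hi j hj
    rcases lt_trichotomy i j with h | h | h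
    · rw [← (lowAdj j hj i h).2, (lowAdj j hj i h).1, G.adj_comm]
    · subst h; simp [diag i hi]
    · exact (lowAdj i hi j h).1

theorem distC_far {c : Fin 5 → V} {u : V} (h : distC G c u = 2) (i : Fin 5) :
    u ≠ c i ∧ ¬ G.Adj u (c i) := by
  have h2 : 2 ≤ G.dist u (c i) := by
    rw [← h]
    exact Finset.inf'_le _ (Finset.mem_univ i)
  constructor
  · rintro rfl
    simp at h2
  · intro ha
    rw [SimpleGraph.dist_eq_one_iff_adj.2 ha] at h2
    omega

end

end ForkProof

theorem minCex_no_two_converging_paths {V : Type} [Fintype V]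
    (G : SimpleGraph V) (hG : MinCex G) (c : Fin 5 → V) (hc : IsC5 G c)
    (u1 u2 : V) (hne : u1 ≠ u2)
    (h1 : distC G c u1 = 2) (h2 : distC G c u2 = 2) (k : Fin 5) :
    ¬ ∃ a b : V, G.Adj (c k) a ∧ G.Adj a u1 ∧ G.Adj (c k) b ∧ G.Adj b u2 ∧
      a ≠ b ∧ a ≠ u2 ∧ b ≠ u1 := by
  rintro ⟨a, b, ha, hau, hb, hbu, hab, hau2, hbu1⟩
  have hC := ForkProof.minCol hG
  have hd : ∀ i j : Fin 5, i ≠ j → c (k + i) ≠ c (k + j) := by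
    intro i j hij h
    exact hij (add_left_cancel (hc.1 h))
  have hadj : ∀ i : Fin 5, G.Adj (c (k + i)) (c (k + (i + 1))) := by
    intro i
    rw [← add_assoc]
    exact hc.2 _
  have hk : c k = c (k + 0) := by rw [add_zero]
  rw [hk] at ha hb
  refine ForkProof.nine_false hC.1 (ForkProof.fbok_all hG) (c (k + 0)) (c (k + 1)) (c (k + 2))
    (c (k + 3)) (c (k + 4)) a b u1 u2 (hadj 0) (hadj 1) (hadj 2) (hadj 3) (hadj 4) ha hb hau hbu
    hab hau2 hbu1 hne ?_ ?_ (hd _ _ (by decide)) (hd _ _ (by decide)) (hd _ _ (by decide))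
    (hd _ _ (by decide)) (hd _ _ (by decide))
  · intro x hx
    simp only [List.mem_cons, List.not_mem_nil, or_false] at hx
    rcases hx with rfl | rfl | rfl | rfl | rfl <;> exact ForkProof.distC_far h1 _
  · intro x hx
    simp only [List.mem_cons, List.not_mem_nil, or_false] at hx
    rcases hx with rfl | rfl | rfl | rfl | rfl <;> exact ForkProof.distC_far h2 _
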